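/- arXiv:1610.03144 — 5 statements merged into one kernel-verified Lean document; each statement's English description precedes it below -/
import Mathlib

section
/- Let n ≥ 1, p > 2, and let Ω be the open unit ball of ℝⁿ. Let ω ⊂ ℝⁿ be any open set, let ε > 0, and set ω_ε = {x ∈ ℝⁿ : dist(x, ω) < ε}. There exist u₀ ∈ X and reals t₀ > 0, c₀ > 0 such that for every family (u_j)_{j≥1} where each u_j is a classical solution of the j-th regularized problem with data u₀: (a) for every x₀ ∈ ω ∩ ∂Ω, liminf_{x→x₀, x∈Ω} sup_{j≥1} u_j(x, t₀) ≥ c₀; and (b) for every x₀ ∈ ∂Ω with x₀ ∉ ω_ε and every t > 0, sup_{j≥1} u_j(x,t) → 0 as x → x₀ with x ∈ Ω. (Thus the loss of boundary conditions set L(u₀) of the global viscosity solution satisfies ω ∩ ∂Ω ⊂ L(u₀) ⊂ ω_ε ∩ ∂Ω, with loss of boundary conditions on ω ∩ ∂Ω at the common time t₀.) -/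
open Set Filter Metric MeasureTheory Topology
open scoped ENNReal

noncomputable section

/-- Euclidean space ℝⁿ. -/
abbrev Euc (n : ℕ) := EuclideanSpace ℝ (Fin n)

/-- Membership in the class `X` of `C¹(Ω̄)` functions that are nonnegative on `Ω̄`
and vanish on `∂Ω`. -/
def MemX {n : ℕ} (Ω : Set (Euc n)) (v : Euc n → ℝ) : Prop :=
  ContDiffOn ℝ 1 v (closure Ω) ∧ (∀ x ∈ closure Ω, 0 ≤ v x) ∧ ∀ x ∈ frontier Ω, v x = 0

/-- The regularized Hamiltonian `F_j(ξ) = min(|ξ|^p, j^{p-2}|ξ|²)`. -/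
def Fj (n : ℕ) (p : ℝ) (j : ℕ) (ξ : Euc n) : ℝ :=
  min (‖ξ‖ ^ p) ((j : ℝ) ^ (p - 2) * ‖ξ‖ ^ 2)

/-- The Laplacian, as the sum of the second partial derivatives. -/
def lap (n : ℕ) (f : Euc n → ℝ) (x : Euc n) : ℝ :=
  ∑ i : Fin n,
    fderiv ℝ (fun y => fderiv ℝ f y (EuclideanSpace.single i 1)) x (EuclideanSpace.single i 1)

/-- `u` is a classical solution of the `j`-th regularized problem
`∂ₜu = Δu + F_j(∇u)` in `Ω × (0,∞)`, `u = 0` on `∂Ω × (0,∞)`, `u(·,0) = u₀`. -/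
structure IsRegSol (n : ℕ) (p : ℝ) (Ω : Set (Euc n)) (j : ℕ) (u0 : Euc n → ℝ)
    (u : Euc n → ℝ → ℝ) : Prop where
  cont : ContinuousOn (fun q : Euc n × ℝ => u q.1 q.2) (closure Ω ×ˢ Ici (0:ℝ))
  nonneg : ∀ x ∈ closure Ω, ∀ t ∈ Ici (0:ℝ), 0 ≤ u x t
  time_reg : ∀ x ∈ Ω, ContDiffOn ℝ 1 (fun s => u x s) (Ioi (0:ℝ))
  space_reg : ∀ t ∈ Ioi (0:ℝ), ContDiffOn ℝ 2 (fun y => u y t) Ω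
  eqn : ∀ x ∈ Ω, ∀ t ∈ Ioi (0:ℝ),
    deriv (fun s => u x s) t = lap n (fun y => u y t) x + Fj n p j (gradient (fun y => u y t) x)
  bc : ∀ x ∈ frontier Ω, ∀ t ∈ Ioi (0:ℝ), u x t = 0
  ic : ∀ x ∈ closure Ω, u x 0 = u0 x

/-- The pointwise supremum `U(x,t) = sup_{j ≥ 1} u_j(x,t)` of a family of approximating
solutions; on `Ω × (0,∞)` this coincides with the global viscosity solution. -/
def Usup {n : ℕ} (u : ℕ → Euc n → ℝ → ℝ) (x : Euc n) (t : ℝ) : ℝ :=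
  ⨆ j : {j : ℕ // 1 ≤ j}, u j.1 x t

/-- The time interval `[0,T)` (as a subset of ℝ), `T ∈ (0,∞]`. -/
def TimeIcc (T : ℝ≥0∞) : Set ℝ := {t : ℝ | 0 ≤ t ∧ ENNReal.ofReal t < T}

/-- The time interval `(0,T)` (as a subset of ℝ), `T ∈ (0,∞]`. -/
def TimeIoo (T : ℝ≥0∞) : Set ℝ := {t : ℝ | 0 < t ∧ ENNReal.ofReal t < T}

/-- `u` is a classical solution of the Dirichlet problem `∂ₜu = Δu + |∇u|^p` in `Ω × (0,T)`,
`u = 0` on `∂Ω × [0,T)`, `u(·,0) = u₀`, with `u` and `∇u` continuous on `Ω̄ × [0,T)`. -/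
structure IsClassicalSol (n : ℕ) (p : ℝ) (Ω : Set (Euc n)) (u0 : Euc n → ℝ)
    (u : Euc n → ℝ → ℝ) (T : ℝ≥0∞) : Prop where
  cont : ContinuousOn (fun q : Euc n × ℝ => u q.1 q.2) (closure Ω ×ˢ TimeIcc T)
  grad_cont : ∃ G : Euc n × ℝ → Euc n, ContinuousOn G (closure Ω ×ˢ TimeIcc T) ∧
    ∀ x ∈ Ω, ∀ t ∈ TimeIoo T, G (x, t) = gradient (fun y => u y t) x
  time_reg : ∀ x ∈ Ω, ContDiffOn ℝ 1 (fun s => u x s) (TimeIoo T)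
  space_reg : ∀ t ∈ TimeIoo T, ContDiffOn ℝ 2 (fun y => u y t) Ω
  eqn : ∀ x ∈ Ω, ∀ t ∈ TimeIoo T,
    deriv (fun s => u x s) t = lap n (fun y => u y t) x + ‖gradient (fun y => u y t) x‖ ^ p
  bc : ∀ x ∈ frontier Ω, ∀ t ∈ TimeIcc T, u x t = 0
  ic : ∀ x ∈ closure Ω, u x 0 = u0 x

theorem deriv_deriv_nonpos_of_isLocalMax {g : ℝ → ℝ} {a : ℝ} (h : IsLocalMax g a)
    (hc : ContinuousAt g a) : deriv (deriv g) a ≤ 0 := by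
  by_contra! hpos
  have hmin : IsLocalMin g a := isLocalMin_of_deriv_deriv_pos hpos h.deriv_eq_zero hc
  have hconst : g =ᶠ[𝓝 a] fun _ => g a := by
    filter_upwards [h, hmin] with s h1 h2 using le_antisymm h1 h2
  have h2 : deriv (deriv g) a = 0 := by
    rw [hconst.deriv.deriv_eq]
    simp
  exact hpos.ne' h2

theorem nonneg_of_hasDerivAt_of_left_max {g : ℝ → ℝ} {g' t : ℝ} (hg : HasDerivAt g g' t)
    (h : ∀ᶠ s in 𝓝[<] t, g s ≤ g t) : 0 ≤ g' := by
  have hs := (hasDerivWithinAt_iff_tendsto_slope' (s := Iio t) (by simp)).1 hg.hasDerivWithinAt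
  refine ge_of_tendsto hs ?_
  filter_upwards [h, self_mem_nhdsWithin] with s h1 h2
  rw [slope_def_field]
  exact div_nonneg_of_nonpos (by linarith) (by linarith [mem_Iio.1 h2])

theorem ContDiffAt.differentiableAt_fderiv_apply {n : ℕ} {f : Euc n → ℝ} {x : Euc n}
    (hf : ContDiffAt ℝ 2 f x) (e : Euc n) : DifferentiableAt ℝ (fun y => fderiv ℝ f y e) x :=
  ((hf.fderiv_right (m := 1) (by norm_num)).differentiableAt (by norm_num)).clm_apply
    (differentiableAt_const e)

theorem ContDiffAt.eventually_differentiableAt {n : ℕ} {f : Euc n → ℝ} {x : Euc n}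
    (hf : ContDiffAt ℝ 2 f x) : ∀ᶠ y in 𝓝 x, DifferentiableAt ℝ f y := by
  filter_upwards [hf.eventually (by simp)] with y hy using hy.differentiableAt (by norm_num)

theorem lap_nonpos_of_isLocalMax {n : ℕ} {f : Euc n → ℝ} {x : Euc n}
    (hf : ContDiffAt ℝ 2 f x) (h : IsLocalMax f x) : lap n f x ≤ 0 := by
  refine Finset.sum_nonpos fun i _ => ?_
  set e : Euc n := EuclideanSpace.single i 1
  have hline : ∀ s : ℝ, HasDerivAt (fun s : ℝ => x + s • e) e s := fun s => by
    simpa using ((hasDerivAt_id s).smul_const e).const_add x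
  have htend : Tendsto (fun s : ℝ => x + s • e) (𝓝 0) (𝓝 x) := by
    simpa using (hline 0).continuousAt.tendsto
  have hd : deriv (fun s : ℝ => f (x + s • e)) =ᶠ[𝓝 0] fun s => fderiv ℝ f (x + s • e) e := by
    filter_upwards [htend.eventually hf.eventually_differentiableAt] with s hs
    exact (hs.hasFDerivAt.comp_hasDerivAt s (hline s)).deriv
  have hdd : deriv (deriv (fun s : ℝ => f (x + s • e))) 0
      = fderiv ℝ (fun y => fderiv ℝ f y e) x e := by
    rw [hd.deriv_eq]
    have h1 := (hf.differentiableAt_fderiv_apply e).hasFDerivAt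
    have h2 : HasFDerivAt (fun y => fderiv ℝ f y e) (fderiv ℝ (fun y => fderiv ℝ f y e) x)
      (x + (0 : ℝ) • e) := by simpa using h1
    exact (h2.comp_hasDerivAt 0 (hline 0)).deriv
  rw [← hdd]
  refine deriv_deriv_nonpos_of_isLocalMax ?_ ?_
  · filter_upwards [htend.eventually h] with s hs
    simpa using hs
  · have hc : ContinuousAt f (x + (0 : ℝ) • e) := by simpa using hf.continuousAt
    exact hc.comp (f := fun s : ℝ => x + s • e) (hline 0).continuousAt

theorem lap_sub {n : ℕ} {f g : Euc n → ℝ} {x : Euc n}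
    (hf : ContDiffAt ℝ 2 f x) (hg : ContDiffAt ℝ 2 g x) :
    lap n (fun y => f y - g y) x = lap n f x - lap n g x := by
  unfold lap
  rw [← Finset.sum_sub_distrib]
  refine Finset.sum_congr rfl fun i _ => ?_
  set e : Euc n := EuclideanSpace.single i 1
  have h : (fun y => fderiv ℝ (fun y => f y - g y) y e)
      =ᶠ[𝓝 x] fun y => fderiv ℝ f y e - fderiv ℝ g y e := by
    filter_upwards [hf.eventually_differentiableAt, hg.eventually_differentiableAt] with y h1 h2
    rw [fderiv_fun_sub h1 h2]
    rfl
  rw [h.fderiv_eq, fderiv_fun_sub (hf.differentiableAt_fderiv_apply e)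
    (hg.differentiableAt_fderiv_apply e)]
  rfl

theorem derivatives_at_parabolic_max {n : ℕ} {a b : Euc n → ℝ → ℝ} {x : Euc n} {t : ℝ}
    (ha : ContDiffAt ℝ 2 (fun y => a y t) x) (hb : ContDiffAt ℝ 2 (fun y => b y t) x)
    (hat : DifferentiableAt ℝ (fun s => a x s) t) (hbt : DifferentiableAt ℝ (fun s => b x s) t)
    (hx : ∀ᶠ y in 𝓝 x, a y t - b y t ≤ a x t - b x t)
    (ht : ∀ᶠ s in 𝓝[<] t, a x s - b x s ≤ a x t - b x t) :
    deriv (fun s => b x s) t ≤ deriv (fun s => a x s) t ∧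
      lap n (fun y => a y t) x ≤ lap n (fun y => b y t) x ∧
      gradient (fun y => a y t) x = gradient (fun y => b y t) x := by
  refine ⟨?_, ?_, ?_⟩
  · have := nonneg_of_hasDerivAt_of_left_max (hat.hasDerivAt.sub hbt.hasDerivAt) ht
    linarith
  · have := lap_nonpos_of_isLocalMax (ha.sub hb) hx
    have h2 := lap_sub ha hb
    change lap n (fun y => a y t - b y t) x ≤ 0 at this
    linarith
  · have h0 : fderiv ℝ (fun y => a y t - b y t) x = 0 := IsLocalMax.fderiv_eq_zero hx
    rw [fderiv_fun_sub (ha.differentiableAt (by norm_num)) (hb.differentiableAt (by norm_num)),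
      sub_eq_zero] at h0
    simp only [gradient, h0]

theorem hasFDerivAt_norm_sub_sq {n : ℕ} (y x : Euc n) :
    HasFDerivAt (fun z : Euc n => ‖z - y‖ ^ 2) ((2 : ℝ) • innerSL ℝ (x - y)) x := by
  have := ((hasFDerivAt_id x).sub_const y).norm_sq
  refine this.congr_fderiv ?_
  ext v
  simp

theorem hasFDerivAt_radial {n : ℕ} {h : ℝ → ℝ} {h' : ℝ} (y x : Euc n)
    (hh : HasDerivAt h h' (‖x - y‖ ^ 2)) :
    HasFDerivAt (fun z : Euc n => h (‖z - y‖ ^ 2)) ((2 * h') • innerSL ℝ (x - y)) x := by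
  have := hh.comp_hasFDerivAt x (hasFDerivAt_norm_sub_sq y x)
  rw [smul_smul, mul_comm] at this
  exact this

theorem gradient_radial {n : ℕ} {h : ℝ → ℝ} {h' : ℝ} (y x : Euc n)
    (hh : HasDerivAt h h' (‖x - y‖ ^ 2)) :
    gradient (fun z : Euc n => h (‖z - y‖ ^ 2)) x = (2 * h') • (x - y) := by
  apply HasGradientAt.gradient
  rw [hasGradientAt_iff_hasFDerivAt]
  refine (hasFDerivAt_radial y x hh).congr_fderiv ?_
  ext v
  simp

theorem lap_radial {n : ℕ} {h h' : ℝ → ℝ} {h'' : ℝ} (y x : Euc n)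
    (hh : ∀ᶠ r in 𝓝 (‖x - y‖ ^ 2), HasDerivAt h (h' r) r)
    (hh' : HasDerivAt h' h'' (‖x - y‖ ^ 2)) :
    lap n (fun z : Euc n => h (‖z - y‖ ^ 2)) x
      = 4 * h'' * ‖x - y‖ ^ 2 + 2 * n * h' (‖x - y‖ ^ 2) := by
  have key : ∀ i : Fin n,
      fderiv ℝ (fun z => fderiv ℝ (fun z : Euc n => h (‖z - y‖ ^ 2)) z
        (EuclideanSpace.single i 1)) x (EuclideanSpace.single i 1)
      = 4 * h'' * ((x - y) i) ^ 2 + 2 * h' (‖x - y‖ ^ 2) := by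
    intro i
    set e : Euc n := EuclideanSpace.single i 1 with he
    have hee : inner ℝ e e = (1 : ℝ) := by simp [he]
    have hi : inner ℝ (x - y) e = (x - y) i := by
      simp [he, EuclideanSpace.inner_single_right]
    have hev : (fun z => fderiv ℝ (fun z : Euc n => h (‖z - y‖ ^ 2)) z e)
        =ᶠ[𝓝 x] fun z => 2 * (h' (‖z - y‖ ^ 2) * inner ℝ (z - y) e) := by
      have hcont := (hasFDerivAt_norm_sub_sq y x).continuousAt
      filter_upwards [hcont.eventually hh] with z hz
      rw [(hasFDerivAt_radial y z hz).fderiv]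
      simp only [_root_.smul_apply, innerSL_apply_apply, smul_eq_mul, mul_assoc]
    have hin : HasFDerivAt (fun z : Euc n => inner ℝ (z - y) e) (innerSL ℝ e) x := by
      have h1 := ((innerSL ℝ e).hasFDerivAt (x := x - y)).comp x ((hasFDerivAt_id x).sub_const y)
      refine (h1.congr_fderiv (by ext; simp)).congr_of_eventuallyEq (Eventually.of_forall fun z => ?_)
      simp [real_inner_comm]
    have hd := ((hasFDerivAt_radial y x hh').mul hin).const_mul 2
    rw [hev.fderiv_eq, HasFDerivAt.fderiv (f := fun z => 2 * (h' (‖z - y‖ ^ 2) * inner ℝ (z - y) e)) hd]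
    simp only [_root_.smul_apply, _root_.add_apply, innerSL_apply_apply,
      smul_eq_mul, hee, hi]
    ring
  unfold lap
  rw [Finset.sum_congr rfl fun i _ => key i, Finset.sum_add_distrib, ← Finset.mul_sum,
    EuclideanSpace.real_norm_sq_eq]
  simp
  ring

theorem Fj_le (n : ℕ) (p : ℝ) (j : ℕ) (ξ : Euc n) : Fj n p j ξ ≤ ‖ξ‖ ^ p := min_le_left _ _

theorem Fj_eq_of_norm_le {n : ℕ} {p : ℝ} (hp : 2 < p) {j : ℕ} {ξ : Euc n} (h : ‖ξ‖ ≤ j) :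
    Fj n p j ξ = ‖ξ‖ ^ p := by
  refine min_eq_left ?_
  rcases (norm_nonneg ξ).eq_or_lt with h0 | h0
  · rw [← h0, Real.zero_rpow (by linarith)]
    simp
  · calc ‖ξ‖ ^ p = ‖ξ‖ ^ (p - 2) * ‖ξ‖ ^ 2 := by
          rw [← Real.rpow_natCast, ← Real.rpow_add h0]
          norm_num
      _ ≤ _ := by
          gcongr

theorem IsRegSol.contDiffAt_space {n : ℕ} {p : ℝ} {Ω : Set (Euc n)} {j : ℕ} {u0 : Euc n → ℝ}
    {u : Euc n → ℝ → ℝ} (hu : IsRegSol n p Ω j u0 u) (hΩ : IsOpen Ω) {x : Euc n} (hx : x ∈ Ω)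
    {t : ℝ} (ht : 0 < t) : ContDiffAt ℝ 2 (fun y => u y t) x :=
  (hu.space_reg t ht).contDiffAt (hΩ.mem_nhds hx)

theorem IsRegSol.differentiableAt_time {n : ℕ} {p : ℝ} {Ω : Set (Euc n)} {j : ℕ} {u0 : Euc n → ℝ}
    {u : Euc n → ℝ → ℝ} (hu : IsRegSol n p Ω j u0 u) {x : Euc n} (hx : x ∈ Ω)
    {t : ℝ} (ht : 0 < t) : DifferentiableAt ℝ (fun s => u x s) t :=
  ((hu.time_reg x hx).contDiffAt (Ioi_mem_nhds ht)).differentiableAt (by norm_num)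

theorem contDiff_radial {n : ℕ} {m : WithTop ℕ∞} (y : Euc n) :
    ContDiff ℝ m (fun z : Euc n => ‖z - y‖ ^ 2) :=
  (contDiff_id.sub contDiff_const).norm_sq ℝ

/-- Comparison with a stationary paraboloid lying above the solution on the parabolic boundary. -/
theorem IsRegSol.le_paraboloid {n : ℕ} {p : ℝ} {j : ℕ} {u0 : Euc n → ℝ}
    {u : Euc n → ℝ → ℝ} (hu : IsRegSol n p (ball 0 1) j u0 u) {a b : ℝ} (hb : 0 ≤ b) {y : Euc n}
    (hF : ∀ x ∈ ball (0 : Euc n) 1, (2 * b * ‖x - y‖) ^ p ≤ 2 * n * b)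
    (hbd : ∀ x ∈ sphere (0 : Euc n) 1, 0 ≤ a - b * ‖x - y‖ ^ 2)
    (h0 : ∀ x ∈ closedBall (0 : Euc n) 1, u0 x ≤ a - b * ‖x - y‖ ^ 2)
    {x : Euc n} (hx : x ∈ closedBall (0 : Euc n) 1) {t : ℝ} (ht : 0 ≤ t) :
    u x t ≤ a - b * ‖x - y‖ ^ 2 := by
  by_contra! hlt
  have hcl : closure (ball (0 : Euc n) 1) = closedBall 0 1 := closure_ball 0 one_ne_zero
  have hfr : frontier (ball (0 : Euc n) 1) = sphere 0 1 := frontier_ball 0 one_ne_zero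
  set θ := (u x t - (a - b * ‖x - y‖ ^ 2)) / (t + 1) with hθ
  have hθ0 : 0 < θ := div_pos (by linarith) (by linarith)
  have hθt : θ * (t + 1) = u x t - (a - b * ‖x - y‖ ^ 2) := by
    rw [hθ]
    field_simp
  have hK : IsCompact (closedBall (0 : Euc n) 1 ×ˢ Icc (0 : ℝ) t) :=
    (isCompact_closedBall _ _).prod isCompact_Icc
  have hcont : ContinuousOn
      (fun q : Euc n × ℝ => u q.1 q.2 - (a - b * ‖q.1 - y‖ ^ 2 + θ * q.2))
      (closedBall (0 : Euc n) 1 ×ˢ Icc (0 : ℝ) t) := by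
    refine (hu.cont.mono ?_).sub (by fun_prop)
    rw [hcl]
    exact prod_mono le_rfl Icc_subset_Ici_self
  obtain ⟨⟨x₁, t₁⟩, ⟨hx₁, ht₁⟩, hmax⟩ := hK.exists_isMaxOn ⟨(x, t), hx, ht, le_rfl⟩ hcont
  have hval := hmax (show (x, t) ∈ _ from ⟨hx, ht, le_rfl⟩)
  simp only [mem_ofPred_eq] at hval hx₁ ht₁
  have hpos : 0 < u x₁ t₁ - (a - b * ‖x₁ - y‖ ^ 2) - θ * t₁ := by linarith
  have ht₁0 : 0 < t₁ := by
    rcases ht₁.1.eq_or_lt with h | h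
    · rw [← h, hu.ic x₁ (hcl ▸ hx₁)] at hpos
      linarith [h0 x₁ hx₁]
    · exact h
  have hx₁b : x₁ ∈ ball (0 : Euc n) 1 := by
    rcases (mem_closedBall_zero_iff.1 hx₁).eq_or_lt with h | h
    · have hs : x₁ ∈ sphere (0 : Euc n) 1 := mem_sphere_zero_iff_norm.2 h
      rw [hu.bc x₁ (hfr ▸ hs) t₁ ht₁0] at hpos
      nlinarith [hbd x₁ hs]
    · exact mem_ball_zero_iff.2 h
  have hw : ContDiff ℝ 2 (fun z : Euc n => a - b * ‖z - y‖ ^ 2 + θ * t₁) :=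
    (contDiff_const.sub (contDiff_const.mul (contDiff_radial y))).add contDiff_const
  obtain ⟨d1, d2, d3⟩ := derivatives_at_parabolic_max (a := u)
    (b := fun z s => a - b * ‖z - y‖ ^ 2 + θ * s)
    (hu.contDiffAt_space isOpen_ball hx₁b ht₁0) hw.contDiffAt
    (hu.differentiableAt_time hx₁b ht₁0) (by fun_prop)
    (by
      filter_upwards [isOpen_ball.mem_nhds hx₁b] with z hz
      exact hmax (show (z, t₁) ∈ _ from ⟨ball_subset_closedBall hz, ht₁⟩))
    (by
      filter_upwards [Ioo_mem_nhdsLT ht₁0] with s hs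
      exact hmax (show (x₁, s) ∈ _ from ⟨hx₁, hs.1.le, hs.2.le.trans ht₁.2⟩))
  have hder : ∀ r : ℝ, HasDerivAt (fun r : ℝ => a - b * r + θ * t₁) (-b) r := fun r => by
    simpa using ((hasDerivAt_id r).const_mul b).const_sub a
  have hlap := lap_radial (h' := fun _ => -b) y x₁ (Eventually.of_forall hder)
    (hasDerivAt_const _ _)
  have hgrad := gradient_radial y x₁ (hder _)
  have htime : deriv (fun s => a - b * ‖x₁ - y‖ ^ 2 + θ * s) t₁ = θ := by
    simp
  have heq := hu.eqn x₁ hx₁b t₁ ht₁0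
  have hFj := Fj_le n p j (gradient (fun z => u z t₁) x₁)
  have hnorm : ‖gradient (fun z => u z t₁) x₁‖ = 2 * b * ‖x₁ - y‖ := by
    rw [d3, hgrad, norm_smul, Real.norm_eq_abs]
    congr 1
    rw [mul_neg, abs_neg, abs_of_nonneg (by positivity)]
  rw [hnorm] at hFj
  have := hF x₁ hx₁b
  rw [hlap] at d2
  rw [htime] at d1
  linarith

/-- Comparison with an expanding bump `G (η + ρ) - G η - C t`, `ρ = R² - t₀ + t - |x - y|²`,
supported in a ball contained in the domain. -/
theorem IsRegSol.ge_expanding_bump {n : ℕ} {p : ℝ} (hp : 2 < p) {j : ℕ} {u0 : Euc n → ℝ}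
    {u : Euc n → ℝ → ℝ} (hu : IsRegSol n p (ball 0 1) j u0 u) {y : Euc n} {R t₀ η C : ℝ}
    (hR : 0 < R) (hR2 : 2 * R ≤ 1) (hyR : ‖y‖ + R ≤ 1) (hη : 0 < η)
    (ht₀ : t₀ ≤ R ^ 2 / 2) (hC : 0 ≤ C) {G G' G'' : ℝ → ℝ}
    (hG : ∀ X, 0 < X → HasDerivAt G (G' X) X) (hG' : ∀ X, 0 < X → HasDerivAt G' (G'' X) X)
    (hG2 : ∀ X, 0 < X → ContDiffAt ℝ 2 G X) (hG'0 : ∀ X, 0 < X → 0 ≤ G' X)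
    (hj : ∀ X, η ≤ X → G' X ≤ j)
    (hineq : ∀ X d, 0 < X → X ≤ η + R ^ 2 → 0 ≤ d → d ≤ R → R ^ 2 / 2 ≤ d ^ 2 + X →
      G' X * (1 + 2 * n) - 4 * d ^ 2 * G'' X < (2 * d * G' X) ^ p + C)
    (h0 : ∀ x, ‖x - y‖ ^ 2 ≤ R ^ 2 - t₀ → G (η + (R ^ 2 - t₀ - ‖x - y‖ ^ 2)) - G η ≤ u0 x)
    {x : Euc n} {t : ℝ} (ht : 0 ≤ t) (htt₀ : t ≤ t₀) (hx : ‖x - y‖ ^ 2 ≤ R ^ 2 - t₀ + t) :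
    G (η + (R ^ 2 - t₀ + t - ‖x - y‖ ^ 2)) - G η - C * t ≤ u x t := by
  by_contra! hlt
  have hcl : closure (ball (0 : Euc n) 1) = closedBall 0 1 := closure_ball 0 one_ne_zero
  set v : Euc n → ℝ → ℝ := fun z s => G (η + (R ^ 2 - t₀ + s - ‖z - y‖ ^ 2)) - G η - C * s
    with hv
  set K : Set (Euc n × ℝ) := {q | (0 ≤ q.2 ∧ q.2 ≤ t₀) ∧ ‖q.1 - y‖ ^ 2 ≤ R ^ 2 - t₀ + q.2} with hKdef
  have hdist : ∀ q ∈ K, ‖q.1 - y‖ ≤ R := fun q hq =>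
    abs_le_of_sq_le_sq' (by linarith [hq.1.2, hq.2]) hR.le |>.2
  have hnorm_le : ∀ q ∈ K, ‖q.1‖ ≤ ‖q.1 - y‖ + ‖y‖ := fun q _ => by
    simpa using norm_add_le (q.1 - y) y
  have hKcl : IsClosed K := by
    have h1 : IsClosed {q : Euc n × ℝ | 0 ≤ q.2} := isClosed_le (by fun_prop) (by fun_prop)
    have h2 : IsClosed {q : Euc n × ℝ | q.2 ≤ t₀} := isClosed_le (by fun_prop) (by fun_prop)
    have h3 : IsClosed {q : Euc n × ℝ | ‖q.1 - y‖ ^ 2 ≤ R ^ 2 - t₀ + q.2} :=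
      isClosed_le (by fun_prop) (by fun_prop)
    exact (h1.inter h2).inter h3
  have hK : IsCompact K := by
    refine ((isCompact_closedBall y R).prod (isCompact_Icc (a := 0) (b := t₀))).of_isClosed_subset
      hKcl fun q hq => ⟨?_, hq.1⟩
    simpa [dist_eq_norm] using hdist q hq
  have hcont : ContinuousOn (fun q : Euc n × ℝ => v q.1 q.2 - u q.1 q.2) K := by
    refine ContinuousOn.sub ?_ (hu.cont.mono fun q hq => ⟨?_, hq.1.1⟩)
    · refine ((ContinuousOn.comp (t := Ioi 0) (g := G)
        (f := fun q : Euc n × ℝ => η + (R ^ 2 - t₀ + q.2 - ‖q.1 - y‖ ^ 2))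
        (fun X hX => (hG X hX).continuousAt.continuousWithinAt) (by fun_prop) ?_).sub
        continuousOn_const).sub (by fun_prop)
      intro q hq
      simp only [mem_Ioi]
      linarith [hq.2]
    · rw [hcl, mem_closedBall_zero_iff]
      linarith [hnorm_le q hq, hdist q hq]
  obtain ⟨⟨x₁, t₁⟩, hq, hmax⟩ := hK.exists_isMaxOn ⟨(x, t), ⟨ht, htt₀⟩, hx⟩ hcont
  have hval := hmax (show (x, t) ∈ K from ⟨⟨ht, htt₀⟩, hx⟩)
  have hdR := hdist _ hq
  have hn1 := hnorm_le _ hq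
  obtain ⟨⟨ht₁0, ht₁⟩, hx₁⟩ := hq
  simp only [mem_ofPred_eq] at hval ht₁0 ht₁ hx₁ hdR hn1
  have hpos : u x₁ t₁ < v x₁ t₁ := by linarith
  have hx₁c : x₁ ∈ closure (ball (0 : Euc n) 1) := by
    rw [hcl, mem_closedBall_zero_iff]
    linarith
  have hx₁lt : ‖x₁ - y‖ ^ 2 < R ^ 2 - t₀ + t₁ := by
    rcases hx₁.eq_or_lt with h | h
    · have h1 : v x₁ t₁ = -(C * t₁) := by simp [hv, h]
      have h2 := hu.nonneg x₁ hx₁c t₁ ht₁0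
      nlinarith
    · exact h
  have ht₁pos : 0 < t₁ := by
    rcases ht₁0.eq_or_lt with h | h
    · subst h
      rw [hu.ic x₁ hx₁c] at hpos
      have := h0 x₁ (by linarith)
      simp only [hv, add_zero, mul_zero, sub_zero] at hpos
      linarith
    · exact h
  have hx₁b : x₁ ∈ ball (0 : Euc n) 1 := by
    rw [mem_ball_zero_iff]
    have : ‖x₁ - y‖ < R := abs_lt_of_sq_lt_sq (by linarith) hR.le |> (le_abs_self _).trans_lt
    linarith
  have hX : 0 < η + (R ^ 2 - t₀ + t₁ - ‖x₁ - y‖ ^ 2) := by linarith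
  have hvs : ContDiffAt ℝ 2 (fun z => v z t₁) x₁ := by
    have h1 : ContDiffAt ℝ 2 (fun z : Euc n => η + (R ^ 2 - t₀ + t₁ - ‖z - y‖ ^ 2)) x₁ :=
      (contDiff_const.add (contDiff_const.sub (contDiff_radial y))).contDiffAt
    exact (((hG2 _ hX).comp x₁ h1).sub contDiffAt_const).sub contDiffAt_const
  have hvt : HasDerivAt (fun s => v x₁ s)
      (G' (η + (R ^ 2 - t₀ + t₁ - ‖x₁ - y‖ ^ 2)) - C) t₁ := by
    have h1 : HasDerivAt (fun s : ℝ => η + (R ^ 2 - t₀ + s - ‖x₁ - y‖ ^ 2)) 1 t₁ :=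
      (((hasDerivAt_id t₁).const_add _).sub_const _).const_add _
    have h2 := (((hG _ hX).comp t₁ h1).sub_const (G η)).sub ((hasDerivAt_id t₁).const_mul C)
    simp only [mul_one] at h2
    exact h2
  obtain ⟨d1, d2, d3⟩ := derivatives_at_parabolic_max (a := v) (b := u) hvs
    (hu.contDiffAt_space isOpen_ball hx₁b ht₁pos) hvt.differentiableAt
    (hu.differentiableAt_time hx₁b ht₁pos)
    (by
      have h1 : ContinuousAt (fun z : Euc n => ‖z - y‖ ^ 2) x₁ := by fun_prop
      filter_upwards [h1.eventually_lt_const hx₁lt] with z hz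
      exact hmax (show (z, t₁) ∈ K from ⟨⟨ht₁0, ht₁⟩, hz.le⟩))
    (by
      have h1 : ContinuousAt (fun s : ℝ => R ^ 2 - t₀ + s) t₁ := by fun_prop
      filter_upwards [Ioo_mem_nhdsLT ht₁pos,
        nhdsWithin_le_nhds (h1.eventually_const_lt hx₁lt)] with s hs hs'
      exact hmax (show (x₁, s) ∈ K from ⟨⟨hs.1.le, hs.2.le.trans ht₁⟩, hs'.le⟩))
  have hder : ∀ r : ℝ, 0 < η + (R ^ 2 - t₀ + t₁ - r) →
      HasDerivAt (fun r : ℝ => η + (R ^ 2 - t₀ + t₁ - r)) (-1) r := fun r _ => by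
    simpa using ((hasDerivAt_id r).const_sub (R ^ 2 - t₀ + t₁)).const_add η
  have hder1 : ∀ r : ℝ, 0 < η + (R ^ 2 - t₀ + t₁ - r) →
      HasDerivAt (fun r : ℝ => G (η + (R ^ 2 - t₀ + t₁ - r)) - G η - C * t₁)
        (-G' (η + (R ^ 2 - t₀ + t₁ - r))) r := fun r hr => by
    simpa using (((hG _ hr).comp r (hder r hr)).sub_const (G η)).sub_const (C * t₁)
  have hder2 : HasDerivAt (fun r : ℝ => -G' (η + (R ^ 2 - t₀ + t₁ - r)))
        (G'' (η + (R ^ 2 - t₀ + t₁ - ‖x₁ - y‖ ^ 2))) (‖x₁ - y‖ ^ 2) := by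
    have h1 := ((hG' _ hX).comp (‖x₁ - y‖ ^ 2) (hder _ hX)).neg
    simp only [mul_neg, mul_one, neg_neg] at h1
    exact h1
  have hev : ∀ᶠ r in 𝓝 (‖x₁ - y‖ ^ 2), 0 < η + (R ^ 2 - t₀ + t₁ - r) := by
    have h1 : ContinuousAt (fun r : ℝ => η + (R ^ 2 - t₀ + t₁ - r)) (‖x₁ - y‖ ^ 2) := by fun_prop
    exact h1.eventually_const_lt hX
  have hlap := lap_radial y x₁ (hev.mono hder1) hder2
  have hgrad := gradient_radial y x₁ (hder1 _ hX)
  have heq := hu.eqn x₁ hx₁b t₁ ht₁pos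
  have hi := hineq _ ‖x₁ - y‖ hX (by linarith [sq_nonneg ‖x₁ - y‖]) (norm_nonneg _) hdR
    (by linarith)
  have hG0 := hG'0 _ hX
  have hGj := hj (η + (R ^ 2 - t₀ + t₁ - ‖x₁ - y‖ ^ 2)) (by linarith)
  set g := G' (η + (R ^ 2 - t₀ + t₁ - ‖x₁ - y‖ ^ 2))
  have hnorm : ‖gradient (fun z => u z t₁) x₁‖ = 2 * ‖x₁ - y‖ * g := by
    rw [← d3, hgrad, norm_smul, Real.norm_eq_abs, mul_neg, abs_neg, abs_of_nonneg (by positivity)]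
    ring
  have hle : ‖gradient (fun z => u z t₁) x₁‖ ≤ j := by
    rw [hnorm]
    nlinarith [norm_nonneg (x₁ - y)]
  rw [Fj_eq_of_norm_le hp hle, hnorm] at heq
  rw [hlap] at d2
  rw [hvt.deriv] at d1
  nlinarith

/-- For `γ = 1 - 2 / p`, the profile `μ log X + κ X ^ γ` generates expanding subsolutions, with
constants uniform in small `μ`. -/
theorem exists_profile_constants {n : ℕ} {p R κ : ℝ} (hp : 2 < p) (hR : 0 < R) (hκ : 0 < κ) :
    ∃ μ₀ > (0 : ℝ), ∃ C > (0 : ℝ), ∀ μ, 0 < μ → μ ≤ μ₀ → ∀ X d : ℝ, 0 < X → X ≤ 1 → 0 ≤ d → d ≤ R →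
      R ^ 2 / 2 ≤ d ^ 2 + X →
      (μ + κ * (1 - 2 / p) * X ^ (1 - 2 / p)) / X * (1 + 2 * n)
        - 4 * d ^ 2 * (-(μ + κ * (1 - 2 / p) * (2 / p) * X ^ (1 - 2 / p)) / X ^ 2)
        < (2 * d * ((μ + κ * (1 - 2 / p) * X ^ (1 - 2 / p)) / X)) ^ p + C := by
  have hp0 : 0 < p := by linarith
  have hβ : 2 / p < 1 := by rw [div_lt_one hp0]; exact hp
  have hβ0 : 0 < 2 / p := by positivity
  set β := 2 / p with hβdef
  set k := κ * (1 - β) with hk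
  have hk0 : 0 < k := mul_pos hκ (by linarith)
  set N : ℝ := 1 + 2 * n + 4 * R ^ 2 with hN
  have hN0 : 0 < N := by positivity
  set A : ℝ := (R * k) ^ p with hA
  have hA0 : 0 < A := by positivity
  set X₁ : ℝ := min ((A / (2 * N * k)) ^ (1 - β)⁻¹) (R ^ 2 / 4) with hX₁
  have hX₁0 : 0 < X₁ := lt_min (by positivity) (by positivity)
  refine ⟨A / (2 * N), by positivity, ((A / (2 * N) + k) * N + 1) / X₁ ^ 2, by positivity, ?_⟩
  intro μ hμ hμ₀ X d hX hX1 hd hdR hdX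
  set Y := X ^ (1 - β) with hY
  have hY0 : 0 < Y := by positivity
  have hY1 : Y ≤ 1 := Real.rpow_le_one hX.le hX1 (by linarith)
  set C : ℝ := ((A / (2 * N) + k) * N + 1) / X₁ ^ 2 with hC
  have hC0 : 0 < C := by positivity
  have hμN : μ * N ≤ A / 2 := by
    calc μ * N ≤ A / (2 * N) * N := by gcongr
      _ = A / 2 := by field_simp
  have hLHS : (μ + k * Y) / X * (1 + 2 * n) - 4 * d ^ 2 * (-(μ + k * β * Y) / X ^ 2)
      ≤ (μ + k * Y) * N / X ^ 2 := by
    have h1 : (μ + k * Y) / X * (1 + 2 * n) - 4 * d ^ 2 * (-(μ + k * β * Y) / X ^ 2)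
      = (X * ((μ + k * Y) * (1 + 2 * n)) + 4 * d ^ 2 * (μ + k * β * Y)) / X ^ 2 := by
      field_simp
      ring
    rw [h1]
    gcongr
    have h2 : X * ((μ + k * Y) * (1 + 2 * n)) ≤ 1 * ((μ + k * Y) * (1 + 2 * n)) := by gcongr
    have h3 : 4 * d ^ 2 * (μ + k * β * Y) ≤ 4 * R ^ 2 * (μ + k * 1 * Y) := by gcongr
    rw [hN]
    linarith
  refine hLHS.trans_lt ?_
  rcases lt_or_ge X X₁ with h | h
  · have hXR : X < R ^ 2 / 4 := h.trans_le (min_le_right _ _)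
    have hd2 : R ≤ 2 * d := by nlinarith
    have hYle : Y ≤ A / (2 * N * k) := by
      calc Y ≤ ((A / (2 * N * k)) ^ (1 - β)⁻¹) ^ (1 - β) := by
            have := h.le.trans (min_le_left _ _)
            exact Real.rpow_le_rpow hX.le this (by linarith)
        _ = _ := Real.rpow_inv_rpow (by positivity) (by linarith)
    have hYN : k * Y * N ≤ A / 2 := by
      calc k * Y * N ≤ k * (A / (2 * N * k)) * N := by gcongr
        _ = A / 2 := by field_simp
    have hpow : A / X ^ 2 ≤ (2 * d * ((μ + k * Y) / X)) ^ p := by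
      have h1 : A / X ^ 2 = (R * (k * Y / X)) ^ p := by
        have h2 : Y / X = X ^ (-β) := by
          rw [hY, ← Real.rpow_sub_one hX.ne']
          congr 1
          ring
        rw [mul_div_assoc, h2, ← mul_assoc, Real.mul_rpow (by positivity) (by positivity),
          ← Real.rpow_mul hX.le, show -β * p = -2 by rw [hβdef]; field_simp,
          Real.rpow_neg hX.le, div_eq_mul_inv, Real.rpow_ofNat]
      rw [h1]
      gcongr
      linarith
    calc (μ + k * Y) * N / X ^ 2 ≤ A / X ^ 2 := by
          gcongr
          linarith
      _ ≤ (2 * d * ((μ + k * Y) / X)) ^ p := hpow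
      _ < _ := by linarith
  · have h1 : (μ + k * Y) * N / X ^ 2 < C := by
      rw [hC]
      have h2 : (μ + k * Y) * N ≤ (A / (2 * N) + k * 1) * N := by gcongr
      calc (μ + k * Y) * N / X ^ 2 ≤ (μ + k * Y) * N / X₁ ^ 2 := by gcongr
        _ < _ := by
          gcongr
          linarith
    have h3 : 0 ≤ (2 * d * ((μ + k * Y) / X)) ^ p := by positivity
    linarith

/-- Solutions whose initial data are at least `M` on slightly shrunk balls are, at a later time
depending only on `M` and the radius, at least `M / 8` on the full ball, once `j` is large. -/
theorem exists_time_forall_ge {n : ℕ} {p M R : ℝ} (hp : 2 < p) (hM : 0 < M) (hR : 0 < R)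
    (hR2 : 2 * R ≤ 1) :
    ∃ t₀ > (0 : ℝ), t₀ ≤ R ^ 2 / 2 ∧ ∀ {x y : Euc n}, ‖y‖ + R ≤ 1 → ‖x - y‖ < R →
      ∃ J : ℕ, ∀ j, J ≤ j → ∀ (u0 : Euc n → ℝ) (u : Euc n → ℝ → ℝ),
        IsRegSol n p (ball 0 1) j u0 u → (∀ z, ‖z - y‖ ^ 2 ≤ R ^ 2 - t₀ → M ≤ u0 z) →
        M / 8 ≤ u x t₀ := by
  obtain ⟨μ₀, hμ₀, C, hC, hineq⟩ := exists_profile_constants (n := n) (κ := M / 2) hp hR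
    (by positivity)
  have hp0 : 0 < p := by linarith
  have hβ : 2 / p < 1 := by rw [div_lt_one hp0]; exact hp
  have hβ0 : 0 < 2 / p := by positivity
  have hR4 : R ^ 2 ≤ 1 / 4 := by nlinarith
  set t₀ : ℝ := min (R ^ 2 / 2) (M / (8 * C)) with ht₀def
  have ht₀ : 0 < t₀ := lt_min (by positivity) (by positivity)
  have ht₀R : t₀ ≤ R ^ 2 / 2 := min_le_left _ _
  have hCt : C * t₀ ≤ M / 8 := by
    calc C * t₀ ≤ C * (M / (8 * C)) := by gcongr; exact min_le_right _ _
      _ = M / 8 := by field_simp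
  refine ⟨t₀, ht₀, ht₀R, fun {x y} hyR hxy => ?_⟩
  set β := 2 / p with hβdef
  set ρ : ℝ := R ^ 2 - ‖x - y‖ ^ 2 with hρ
  have hρ0 : 0 < ρ := by
    rw [hρ]
    nlinarith [norm_nonneg (x - y)]
  set L : ℝ := max 1 (max (M / (2 * μ₀)) (-2 * Real.log ρ)) with hL
  have hL1 : 1 ≤ L := le_max_left _ _
  have hL2 : M / (2 * μ₀) ≤ L := (le_max_left _ _).trans (le_max_right _ _)
  have hL3 : -2 * Real.log ρ ≤ L := (le_max_right _ _).trans (le_max_right _ _)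
  have hL0 : 0 < L := by linarith
  set η : ℝ := Real.exp (-L) with hηdef
  have hη : 0 < η := Real.exp_pos _
  have hlogη : Real.log η = -L := Real.log_exp _
  have hη2 : η ≤ 1 / 2 := by
    have h1 : η ≤ Real.exp (-1) := Real.exp_le_exp.2 (by linarith)
    linarith [Real.exp_neg_one_lt_half]
  set μ : ℝ := M / (2 * L) with hμdef
  have hμ : 0 < μ := by positivity
  have hμL : μ * L = M / 2 := by
    rw [hμdef]
    field_simp
  have hμμ₀ : μ ≤ μ₀ := by
    rw [hμdef, div_le_iff₀ (by positivity)]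
    rw [div_le_iff₀ (by positivity)] at hL2
    linarith
  set k : ℝ := M / 2 * (1 - β) with hk
  have hk0 : 0 < k := mul_pos (by positivity) (by linarith)
  have hG : ∀ X : ℝ, 0 < X → HasDerivAt (fun X => μ * Real.log X + M / 2 * X ^ (1 - β))
      ((μ + k * X ^ (1 - β)) / X) X := fun X hX => by
    refine (((Real.hasDerivAt_log hX.ne').const_mul μ).add
      ((Real.hasDerivAt_rpow_const (Or.inl hX.ne')).const_mul (M / 2))).congr_deriv ?_
    rw [Real.rpow_sub_one hX.ne', hk]
    field_simp
  have hG' : ∀ X : ℝ, 0 < X → HasDerivAt (fun X => (μ + k * X ^ (1 - β)) / X)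
      (-(μ + k * β * X ^ (1 - β)) / X ^ 2) X := fun X hX => by
    refine ((((Real.hasDerivAt_rpow_const (Or.inl hX.ne')).const_mul k).const_add μ).div
      (hasDerivAt_id X) hX.ne').congr_deriv ?_
    rw [Real.rpow_sub_one hX.ne']
    simp only [id]
    field_simp
    ring
  have hG2 : ∀ X : ℝ, 0 < X →
      ContDiffAt ℝ 2 (fun X => μ * Real.log X + M / 2 * X ^ (1 - β)) X := fun X hX =>
    (contDiffAt_const.mul (Real.contDiffAt_log.2 hX.ne')).add
      (contDiffAt_const.mul (Real.contDiffAt_rpow_const_of_ne hX.ne'))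
  have hanti : ∀ X : ℝ, η ≤ X →
      (μ + k * X ^ (1 - β)) / X ≤ μ / η + k * η ^ (-β) := fun X hX => by
    have hX0 : 0 < X := hη.trans_le hX
    have h1 : (μ + k * X ^ (1 - β)) / X = μ / X + k * X ^ (-β) := by
      rw [show -β = 1 - β - 1 by ring, Real.rpow_sub_one hX0.ne']
      ring
    rw [h1]
    have h2 := Real.rpow_le_rpow_of_nonpos hη hX (show -β ≤ 0 by linarith)
    gcongr
  refine ⟨⌈μ / η + k * η ^ (-β)⌉₊, fun j hj u0 u hu hu0 => ?_⟩
  have hjR : μ / η + k * η ^ (-β) ≤ j := (Nat.le_ceil _).trans (by exact_mod_cast hj)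
  have hηβ : 0 < η ^ (1 - β) := by positivity
  have main := hu.ge_expanding_bump hp hR hR2 hyR hη ht₀R hC.le hG hG' hG2
    (fun X hX => by positivity) (fun X hX => (hanti X hX).trans hjR)
    (fun X d hX hXη hd hdR hdX => hineq μ hμ hμμ₀ X d hX (by linarith) hd hdR hdX)
    (fun z hz => by
      refine le_trans ?_ (hu0 z hz)
      set X := η + (R ^ 2 - t₀ - ‖z - y‖ ^ 2)
      have hX0 : 0 < X := by linarith
      have hX1 : X ≤ 1 := by linarith [sq_nonneg ‖z - y‖]
      have h1 : Real.log X ≤ 0 := Real.log_nonpos hX0.le hX1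
      have h2 : X ^ (1 - β) ≤ 1 := Real.rpow_le_one hX0.le hX1 (by linarith)
      simp only [hlogη]
      nlinarith)
    (x := x) ht₀.le le_rfl (by linarith)
  refine le_trans ?_ main
  rw [show η + (R ^ 2 - t₀ + t₀ - ‖x - y‖ ^ 2) = η + ρ by rw [hρ]; ring]
  have h1 : Real.log ρ ≤ Real.log (η + ρ) := Real.log_le_log hρ0 (by linarith)
  have h2 : η ^ (1 - β) ≤ (η + ρ) ^ (1 - β) :=
    Real.rpow_le_rpow hη.le (by linarith) (by linarith)
  simp only [hlogη]
  nlinarith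

/-- Smooth initial data of height `M`, supported near `ω` and equal to `M` near `ω` at a positive
distance from the unit sphere. -/
theorem exists_initial_data {n : ℕ} (ω : Set (Euc n)) {ε M R t₀ : ℝ} (hε : 0 < ε) (hM : 0 < M)
    (hR : 0 < R) (ht₀ : 0 < t₀) :
    ∃ u0 : Euc n → ℝ, MemX (ball 0 1) u0 ∧ (∀ x, u0 x ≤ M) ∧
      (∀ x, x ∉ thickening (ε / 2) ω → u0 x = 0) ∧
      ∀ x, ∀ e ∈ ω, dist x e ≤ ε / 4 → ‖x‖ ≤ 1 - R + √(R ^ 2 - t₀) → u0 x = M := by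
  have hsq : √(R ^ 2 - t₀) < R := by
    rw [Real.sqrt_lt' hR]
    linarith
  set s : Set (Euc n) := (thickening (ε / 2) ω)ᶜ ∪ (ball 0 1)ᶜ
  set t : Set (Euc n) := cthickening (ε / 4) ω ∩ closedBall 0 (1 - R + √(R ^ 2 - t₀))
  have hs : IsClosed s := isOpen_thickening.isClosed_compl.union isOpen_ball.isClosed_compl
  have ht : IsClosed t := isClosed_cthickening.inter isClosed_closedBall
  have hd : Disjoint s t := by
    rw [disjoint_right]
    rintro x ⟨h1, h2⟩ (h3 | h3)
    · exact h3 (cthickening_subset_thickening' (by positivity) (by linarith) ω h1)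
    · exact h3 (closedBall_subset_ball (by linarith) h2)
  obtain ⟨f, hf0, hf1, hf⟩ := exists_contMDiffMap_zero_one_of_isClosed
    (modelWithCornersSelf ℝ (Euc n)) (n := 1) hs ht hd
  refine ⟨fun x => M * f x, ⟨?_, ?_, ?_⟩, fun x => ?_, fun x hx => ?_, fun x e he hxe hx => ?_⟩
  · exact (contDiff_const.mul f.contMDiff.contDiff).contDiffOn
  · exact fun x _ => mul_nonneg hM.le (hf x).1
  · intro x hx
    rw [frontier_ball 0 one_ne_zero, mem_sphere_zero_iff_norm] at hx
    have : x ∈ s := Or.inr (by simp [hx])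
    simp [hf0 this]
  · nlinarith [(hf x).2]
  · have : x ∈ s := Or.inl hx
    simp [hf0 this]
  · have : x ∈ t := ⟨mem_cthickening_of_dist_le x e _ _ he hxe, mem_closedBall_zero_iff.2 hx⟩
    simp [hf1 this]

/-- **Theorem 5 of Porretta–Souplet** (for the unit ball). For any open set `ω ⊂ ℝⁿ` and any
`ε > 0`, there exist `u₀ ∈ X` and `t₀, c₀ > 0` such that the global viscosity solution with
data `u₀` loses the boundary conditions (with value at least `c₀` at time `t₀`) at every point
of `ω ∩ ∂Ω`, while no loss of boundary conditions occurs outside the `ε`-neighborhood `ω_ε`. -/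
theorem prescribed_loss_of_bc_set (n : ℕ) (hn : 1 ≤ n) (p : ℝ) (hp : 2 < p)
    (ω : Set (Euc n)) (hω : IsOpen ω) (ε : ℝ) (hε : 0 < ε) :
    ∃ u0 : Euc n → ℝ, MemX (ball (0 : Euc n) 1) u0 ∧ ∃ t₀ > (0:ℝ), ∃ c₀ > (0:ℝ),
      ∀ u : ℕ → Euc n → ℝ → ℝ,
        (∀ j, 1 ≤ j → IsRegSol n p (ball (0 : Euc n) 1) j u0 (u j)) →
        (∀ x₀ ∈ ω ∩ frontier (ball (0 : Euc n) 1),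
          c₀ ≤ liminf (fun x => Usup u x t₀) (nhdsWithin x₀ (ball (0 : Euc n) 1))) ∧
        (∀ x₀ ∈ frontier (ball (0 : Euc n) 1), x₀ ∉ Metric.thickening ε ω →
          ∀ t > (0:ℝ),
            Tendsto (fun x => Usup u x t) (nhdsWithin x₀ (ball (0 : Euc n) 1)) (nhds 0)) := by
  set M : ℝ := ε ^ 2 / 32 with hM
  have hM0 : 0 < M := by positivity
  set R : ℝ := min (1 / 2) (ε / 8) with hRdef
  have hR : 0 < R := lt_min (by norm_num) (by positivity)
  have hR2 : 2 * R ≤ 1 := by linarith [min_le_left (1 / 2) (ε / 8)]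
  have hRε : R ≤ ε / 8 := min_le_right _ _
  obtain ⟨t₀, ht₀, ht₀R, hbump⟩ := exists_time_forall_ge (n := n) hp hM0 hR hR2
  obtain ⟨u0, hX, hle, hzero, hone⟩ := exists_initial_data ω hε hM0 hR ht₀
  have hfr : frontier (ball (0 : Euc n) 1) = sphere 0 1 := frontier_ball 0 one_ne_zero
  refine ⟨u0, hX, t₀, ht₀, M / 8, by positivity, fun u hu => ?_⟩
  have hbound : ∀ j : {j : ℕ // 1 ≤ j}, ∀ x ∈ ball (0 : Euc n) 1, ∀ t, 0 ≤ t → u j.1 x t ≤ M := by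
    intro j x hx t ht
    have := (hu j.1 j.2).le_paraboloid (a := M) (b := 0) (y := 0) le_rfl
      (fun z _ => by simp [Real.zero_rpow (show p ≠ 0 by linarith)])
      (fun z _ => by simpa using hM0.le) (fun z _ => by simpa using hle z)
      (ball_subset_closedBall hx) ht
    simpa using this
  have hUM : ∀ x ∈ ball (0 : Euc n) 1, ∀ t, 0 ≤ t → Usup u x t ≤ M := fun x hx t ht =>
    Real.iSup_le (fun j => hbound j x hx t ht) hM0.le
  refine ⟨fun x₀ hx₀ => ?_, fun x₀ hx₀ hx₀ω t ht => ?_⟩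
  · obtain ⟨hx₀ω, hx₀s⟩ := hx₀
    rw [hfr, mem_sphere_zero_iff_norm] at hx₀s
    have : (𝓝[ball (0 : Euc n) 1] x₀).NeBot := by
      rw [← mem_closure_iff_nhdsWithin_neBot, closure_ball 0 one_ne_zero]
      exact mem_closedBall_zero_iff.2 hx₀s.le
    have hbdd : IsBoundedUnder (· ≤ ·) (𝓝[ball (0 : Euc n) 1] x₀) (fun x => Usup u x t₀) :=
      isBoundedUnder_of_eventually_le (a := M) (by
        filter_upwards [self_mem_nhdsWithin] with x hx using hUM x hx t₀ ht₀.le)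
    refine le_liminf_of_le hbdd.isCoboundedUnder_ge ?_
    have hx₀0 : x₀ ≠ 0 := by
      rintro rfl
      simp at hx₀s
    have hc : ContinuousAt (fun x : Euc n => ‖x‖⁻¹ • x) x₀ :=
      (continuous_norm.continuousAt.inv₀ (norm_ne_zero_iff.2 hx₀0)).smul continuousAt_id
    have hω' : ∀ᶠ x in 𝓝 x₀, ‖x‖⁻¹ • x ∈ ω :=
      hc.eventually (hω.mem_nhds (by simpa [hx₀s] using hx₀ω))
    have hnear : ∀ᶠ x in 𝓝 x₀, 1 - R < ‖x‖ :=
      continuous_norm.continuousAt.eventually_const_lt (by linarith)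
    filter_upwards [self_mem_nhdsWithin, nhdsWithin_le_nhds hω', nhdsWithin_le_nhds hnear]
      with x hx h1 h2
    have hx1 := mem_ball_zero_iff.1 hx
    have hxpos : 0 < ‖x‖ := by linarith
    set e := ‖x‖⁻¹ • x with he
    have hen : ‖e‖ = 1 := by
      rw [he, norm_smul, norm_inv, norm_norm, inv_mul_cancel₀ hxpos.ne']
    have hxe : x = ‖x‖ • e := by rw [he, smul_inv_smul₀ hxpos.ne']
    have hxy : ‖x - (1 - R) • e‖ = ‖x‖ - (1 - R) := by
      nth_rewrite 1 [hxe]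
      rw [← sub_smul, norm_smul, hen, mul_one, Real.norm_eq_abs, abs_of_pos (by linarith)]
    have hyn : ‖(1 - R) • e‖ = 1 - R := by
      rw [norm_smul, hen, mul_one, Real.norm_eq_abs, abs_of_pos (by linarith)]
    obtain ⟨J, hJ⟩ := hbump (x := x) (y := (1 - R) • e) (by rw [hyn]; linarith)
      (by rw [hxy]; linarith)
    have hj : 1 ≤ J + 1 := by omega
    refine (hJ (J + 1) (by omega) u0 (u (J + 1)) (hu (J + 1) hj) fun z hz => ?_).trans
      (le_ciSup (f := fun j : {j : ℕ // 1 ≤ j} => u j.1 x t₀)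
        ⟨M, by rintro _ ⟨j, rfl⟩; exact hbound j x hx t₀ ht₀.le⟩ ⟨J + 1, hj⟩)
    refine (hone z e h1 ?_ ?_).ge
    · have h3 : ‖z - (1 - R) • e‖ ≤ R :=
        abs_le_of_sq_le_sq' (by linarith) hR.le |>.2
      have h4 : ‖(1 - R) • e - e‖ = R := by
        rw [show (1 - R) • e - e = (-R) • e by module, norm_smul, hen, Real.norm_eq_abs,
          abs_neg, abs_of_pos hR, mul_one]
      have h5 := norm_sub_le_norm_sub_add_norm_sub z ((1 - R) • e) e
      rw [dist_eq_norm]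
      linarith
    · have h3 : ‖z - (1 - R) • e‖ ≤ √(R ^ 2 - t₀) := Real.le_sqrt_of_sq_le hz
      have h4 : ‖z‖ ≤ ‖z - (1 - R) • e‖ + ‖(1 - R) • e‖ := by
        simpa using norm_add_le (z - (1 - R) • e) ((1 - R) • e)
      rw [hyn] at h4
      linarith
  · rw [hfr, mem_sphere_zero_iff_norm] at hx₀
    have hn' : (1 : ℝ) ≤ n := by exact_mod_cast hn
    have hφ : ∀ x : Euc n, 1 / 2 - 1 / 8 * ‖x - -x₀‖ ^ 2
        = (1 - ‖x‖ ^ 2) / 4 + ‖x - x₀‖ ^ 2 / 8 := fun x => by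
      have h1 := parallelogram_law_with_norm ℝ x x₀
      rw [hx₀] at h1
      rw [sub_neg_eq_add]
      linarith
    have hbar : ∀ x ∈ ball (0 : Euc n) 1, Usup u x t ≤ 1 / 2 - 1 / 8 * ‖x - -x₀‖ ^ 2 := by
      intro x hx
      have hbase : ∀ z ∈ closedBall (0 : Euc n) 1, 0 ≤ 1 / 2 - 1 / 8 * ‖z - -x₀‖ ^ 2 := by
        intro z hz
        have hz1 := mem_closedBall_zero_iff.1 hz
        rw [hφ]
        nlinarith [norm_nonneg z, sq_nonneg ‖z - x₀‖]
      refine Real.iSup_le (fun j => ?_) (hbase x (ball_subset_closedBall hx))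
      refine (hu j.1 j.2).le_paraboloid (by norm_num) (fun z hz => ?_)
        (fun z hz => hbase z (sphere_subset_closedBall hz)) (fun z hz => ?_)
        (ball_subset_closedBall hx) ht.le
      · have hz1 := mem_ball_zero_iff.1 hz
        have h1 : ‖z - -x₀‖ ≤ 2 := by
          have := norm_sub_le z (-x₀)
          rw [norm_neg, hx₀] at this
          linarith
        calc (2 * (1 / 8) * ‖z - -x₀‖) ^ p ≤ (1 / 2 : ℝ) ^ p :=
              Real.rpow_le_rpow (by positivity) (by linarith) (by linarith)
          _ ≤ (1 / 2 : ℝ) ^ (2 : ℝ) :=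
              Real.rpow_le_rpow_of_exponent_ge (by norm_num) (by norm_num) hp.le
          _ ≤ 2 * n * (1 / 8) := by
              norm_num
              linarith
      · by_cases hz2 : ε / 2 ≤ ‖z - x₀‖
        · have hz1 := mem_closedBall_zero_iff.1 hz
          rw [hφ]
          have := hle z
          nlinarith [norm_nonneg z]
        · rw [hzero z fun hzω => hx₀ω ?_]
          · exact hbase z hz
          · obtain ⟨w, hw, hzw⟩ := mem_thickening_iff.1 hzω
            refine mem_thickening_iff.2 ⟨w, hw, ?_⟩
            have := dist_triangle x₀ z w
            rw [dist_comm x₀ z, dist_eq_norm z x₀] at this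
            linarith
    have hlim : Tendsto (fun x : Euc n => 1 / 2 - 1 / 8 * ‖x - -x₀‖ ^ 2)
        (𝓝[ball (0 : Euc n) 1] x₀) (𝓝 0) := by
      have h1 : ContinuousAt (fun x : Euc n => 1 / 2 - 1 / 8 * ‖x - -x₀‖ ^ 2) x₀ := by fun_prop
      have h2 := h1.tendsto
      rw [hφ x₀] at h2
      simp only [hx₀, sub_self, norm_zero] at h2
      norm_num at h2
      refine Tendsto.mono_left ?_ nhdsWithin_le_nhds
      convert h2 using 3
      norm_num
    refine squeeze_zero' ?_ ?_ hlim
    · filter_upwards [self_mem_nhdsWithin] with x hx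
      exact Real.iSup_nonneg fun j => (hu j.1 j.2).nonneg x (subset_closure hx) t ht.le
    · filter_upwards [self_mem_nhdsWithin] with x hx using hbar x hx

end
end

section
/- Let n ≥ 1, let Ω ⊂ ℝⁿ be a bounded open set, let p > 2, and let u₀ ∈ X. If u is a classical solution of the Dirichlet problem u_t − Δu = |∇u|^p, u = 0 on ∂Ω, u(·,0) = u₀, on Ω̄ × [0,T) with 0 < T ≤ ∞, then for all 0 < t₀ ≤ t < T one has sup_{x∈Ω} |∂_t u(x,t)| ≤ sup_{x∈Ω} |∂_t u(x,t₀)| (an inequality in [0,∞]). In particular, the sup-norm of the time derivative is nonincreasing in time. -/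
open Set Filter Metric MeasureTheory Topology
open scoped ENNReal

noncomputable section

/-- Regularity on the parabolic cylinder `Ω × (a, b]` needed for the maximum principle. -/
structure CylinderRegular {n : ℕ} (Ω : Set (Euc n)) (a b : ℝ) (w : Euc n → ℝ → ℝ) : Prop where
  cont : ContinuousOn (fun q : Euc n × ℝ => w q.1 q.2) (closure Ω ×ˢ Icc a b)
  time_diff : ∀ x ∈ Ω, ∀ s ∈ Ioc a b, DifferentiableAt ℝ (fun r => w x r) s
  space_reg : ∀ s ∈ Ioc a b, ContDiffOn ℝ 2 (fun y => w y s) Ω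

/-- The spatial operator `Δf + |∇f|^p`. -/
def spatialOp (n : ℕ) (p : ℝ) (f : Euc n → ℝ) (x : Euc n) : ℝ :=
  lap n f x + ‖gradient f x‖ ^ p

lemma spatialOp_add_const (n : ℕ) (p : ℝ) (f : Euc n → ℝ) (c : ℝ) (x : Euc n) :
    spatialOp n p (fun y => f y + c) x = spatialOp n p f x := by
  simp [spatialOp, lap, gradient, fderiv_add_const]

lemma IsLocalMax.deriv_deriv_nonpos {g : ℝ → ℝ} {x : ℝ} (hmax : IsLocalMax g x)
    (hc : ContinuousAt g x) : deriv (deriv g) x ≤ 0 := by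
  by_contra! hpos
  have hmin := isLocalMin_of_deriv_deriv_pos hpos hmax.deriv_eq_zero hc
  have heq : g =ᶠ[𝓝 x] fun _ => g x := by
    filter_upwards [hmin, hmax] with y h1 h2 using le_antisymm h2 h1
  have := heq.deriv.deriv_eq
  simp at this
  linarith

lemma lap_le_of_isLocalMax_sub {n : ℕ} {Ω : Set (Euc n)} (hΩ : IsOpen Ω) {f g : Euc n → ℝ}
    (hf : ContDiffOn ℝ 2 f Ω) (hg : ContDiffOn ℝ 2 g Ω) {x : Euc n} (hx : x ∈ Ω)
    (hmax : IsLocalMax (fun y => f y - g y) x) : lap n f x ≤ lap n g x := by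
  have first : ∀ {k : Euc n → ℝ}, ContDiffOn ℝ 2 k Ω → ∀ y ∈ Ω, DifferentiableAt ℝ k y :=
    fun hk y hy => (hk.contDiffAt (hΩ.mem_nhds hy)).differentiableAt (by norm_num)
  have second : ∀ {k : Euc n → ℝ}, ContDiffOn ℝ 2 k Ω → ∀ e : Euc n,
      DifferentiableAt ℝ (fun y => fderiv ℝ k y e) x := by
    intro k hk e
    have h := (hk.contDiffAt (hΩ.mem_nhds hx)).fderiv_right (m := 1) (by norm_num)
    exact (h.differentiableAt (by norm_num)).clm_apply (differentiableAt_const e)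
  refine Finset.sum_le_sum fun i _ => ?_
  set e : Euc n := EuclideanSpace.single i 1
  have hline : ∀ r : ℝ, HasDerivAt (fun r : ℝ => x + r • e) e r := fun r => by
    simpa using ((hasDerivAt_id r).smul_const e).const_add x
  have hzero : x + (0 : ℝ) • e = x := by simp
  have htend : Tendsto (fun r : ℝ => x + r • e) (𝓝 0) (𝓝 x) := by
    simpa [ContinuousAt] using (hline 0).continuousAt
  have hderiv : deriv (fun r : ℝ => f (x + r • e) - g (x + r • e)) =ᶠ[𝓝 0]
      fun r => fderiv ℝ f (x + r • e) e - fderiv ℝ g (x + r • e) e := by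
    filter_upwards [htend.eventually (hΩ.mem_nhds hx)] with r hr
    exact (((first hf _ hr).hasFDerivAt.comp_hasDerivAt r (hline r)).sub
      ((first hg _ hr).hasFDerivAt.comp_hasDerivAt r (hline r))).deriv
  have hderiv2 : deriv (deriv fun r : ℝ => f (x + r • e) - g (x + r • e)) 0 =
      fderiv ℝ (fun y => fderiv ℝ f y e) x e - fderiv ℝ (fun y => fderiv ℝ g y e) x e := by
    rw [hderiv.deriv_eq]
    exact (((second hf e).hasFDerivAt.comp_hasDerivAt_of_eq 0 (hline 0) hzero.symm).sub
      ((second hg e).hasFDerivAt.comp_hasDerivAt_of_eq 0 (hline 0) hzero.symm)).deriv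
  have hmax' : IsLocalMax (fun r : ℝ => f (x + r • e) - g (x + r • e)) 0 := by
    have := htend.eventually hmax
    simpa [IsLocalMax, IsMaxFilter] using this
  have hc : ContinuousAt (fun r : ℝ => f (x + r • e) - g (x + r • e)) 0 := by
    have h : ContinuousAt (fun y => f y - g y) (x + (0 : ℝ) • e) := by
      rw [hzero]
      exact (first hf x hx).continuousAt.sub (first hg x hx).continuousAt
    exact ContinuousAt.comp (f := fun r : ℝ => x + r • e) h (hline 0).continuousAt
  have := hmax'.deriv_deriv_nonpos hc
  linarith

lemma spatialOp_le_of_isLocalMax_sub {n : ℕ} (p : ℝ) {Ω : Set (Euc n)} (hΩ : IsOpen Ω)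
    {f g : Euc n → ℝ} (hf : ContDiffOn ℝ 2 f Ω) (hg : ContDiffOn ℝ 2 g Ω) {x : Euc n}
    (hx : x ∈ Ω) (hmax : IsLocalMax (fun y => f y - g y) x) :
    spatialOp n p f x ≤ spatialOp n p g x := by
  have hdf := (hf.contDiffAt (hΩ.mem_nhds hx)).differentiableAt (by norm_num)
  have hdg := (hg.contDiffAt (hΩ.mem_nhds hx)).differentiableAt (by norm_num)
  have hgrad : fderiv ℝ f x = fderiv ℝ g x := by
    have := hmax.fderiv_eq_zero
    rw [fderiv_fun_sub hdf hdg] at this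
    exact sub_eq_zero.mp this
  have := lap_le_of_isLocalMax_sub hΩ hf hg hx hmax
  simp only [spatialOp, gradient, hgrad]
  linarith

lemma HasDerivAt.nonneg_of_isMaxOn_Icc {f : ℝ → ℝ} {f' a s : ℝ} (hf : HasDerivAt f f' s)
    (has : a < s) (hmax : IsMaxOn f (Icc a s) s) : 0 ≤ f' := by
  have hseg : segment ℝ s a ⊆ Icc a s := by rw [segment_symm, segment_eq_Icc has.le]
  have h := hmax.localize.hasFDerivWithinAt_nonpos hf.hasFDerivAt.hasFDerivWithinAt
    (sub_mem_posTangentConeAt_of_segment_subset hseg)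
  simp at h
  nlinarith

/-- Comparison principle for `∂ₜw = Δw + |∇w|^p` on a bounded cylinder. -/
lemma comparison_principle {n : ℕ} (p : ℝ) {Ω : Set (Euc n)} (hΩo : IsOpen Ω)
    (hΩb : Bornology.IsBounded Ω) {a b : ℝ} {v w : Euc n → ℝ → ℝ}
    (hv : CylinderRegular Ω a b v) (hw : CylinderRegular Ω a b w)
    (hsub : ∀ x ∈ Ω, ∀ s ∈ Ioc a b,
      deriv (fun r => v x r) s ≤ spatialOp n p (fun y => v y s) x)
    (hsuper : ∀ x ∈ Ω, ∀ s ∈ Ioc a b,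
      spatialOp n p (fun y => w y s) x ≤ deriv (fun r => w x r) s)
    (hbc : ∀ x ∈ frontier Ω, ∀ s ∈ Icc a b, v x s ≤ w x s)
    (hic : ∀ x ∈ closure Ω, v x a ≤ w x a) :
    ∀ x ∈ closure Ω, ∀ s ∈ Icc a b, v x s ≤ w x s := by
  intro x₁ hx₁ s₁ hs₁
  suffices key : ∀ ε > 0, v x₁ s₁ - w x₁ s₁ - ε * (s₁ - a) ≤ 0 by
    by_contra! hlt
    have hpos : 0 < s₁ - a + 1 := by linarith [hs₁.1]
    have h := key ((v x₁ s₁ - w x₁ s₁) / (s₁ - a + 1)) (div_pos (by linarith) hpos)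
    have h2 : (v x₁ s₁ - w x₁ s₁) / (s₁ - a + 1) * (s₁ - a + 1) = v x₁ s₁ - w x₁ s₁ :=
      div_mul_cancel₀ _ hpos.ne'
    have h3 : 0 < (v x₁ s₁ - w x₁ s₁) / (s₁ - a + 1) := div_pos (by linarith) hpos
    linarith
  intro ε hε
  have hcomp : IsCompact (closure Ω ×ˢ Icc a b) := hΩb.isCompact_closure.prod isCompact_Icc
  have hcont : ContinuousOn (fun q : Euc n × ℝ => v q.1 q.2 - w q.1 q.2 - ε * (q.2 - a))
      (closure Ω ×ˢ Icc a b) := (hv.cont.sub hw.cont).sub (by fun_prop)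
  obtain ⟨⟨x, s⟩, ⟨hx, hs⟩, hmax⟩ := hcomp.exists_isMaxOn ⟨(x₁, s₁), hx₁, hs₁⟩ hcont
  simp only at hx hs
  have hle : ∀ y ∈ closure Ω, ∀ r ∈ Icc a b,
      v y r - w y r - ε * (r - a) ≤ v x s - w x s - ε * (s - a) :=
    fun y hy r hr => hmax (show (y, r) ∈ closure Ω ×ˢ Icc a b from ⟨hy, hr⟩)
  by_contra! hpos
  have hpos' := hpos.trans_le (hle x₁ hx₁ s₁ hs₁)
  have hsa : 0 ≤ ε * (s - a) := mul_nonneg hε.le (sub_nonneg.mpr hs.1)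
  have hxΩ : x ∈ Ω := by
    by_contra hxn
    have := hbc x (by rw [hΩo.frontier_eq]; exact ⟨hx, hxn⟩) s hs
    linarith
  have hs' : a < s := by
    refine lt_of_le_of_ne hs.1 fun h => ?_
    have := hic x hx
    subst h
    linarith
  have hsI : s ∈ Ioc a b := ⟨hs', hs.2⟩
  have hspace : IsLocalMax (fun y => v y s - w y s) x := by
    filter_upwards [hΩo.mem_nhds hxΩ] with y hy
    linarith [hle y (subset_closure hy) s hs]
  have hop := spatialOp_le_of_isLocalMax_sub p hΩo (hv.space_reg s hsI) (hw.space_reg s hsI)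
    hxΩ hspace
  have htime : HasDerivAt (fun r => v x r - w x r - ε * (r - a))
      (deriv (fun r => v x r) s - deriv (fun r => w x r) s - ε * 1) s :=
    ((hv.time_diff x hxΩ s hsI).hasDerivAt.sub (hw.time_diff x hxΩ s hsI).hasDerivAt).sub
      (((hasDerivAt_id s).sub_const a).const_mul ε)
  have := htime.nonneg_of_isMaxOn_Icc hs' fun r hr => hle x hx r ⟨hr.1, hr.2.trans hs.2⟩
  linarith [hsub x hxΩ s hsI, hsuper x hxΩ s hsI]

lemma isOpen_timeIoo (T : ℝ≥0∞) : IsOpen (TimeIoo T) :=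
  isOpen_Ioi.inter (isOpen_Iio.preimage ENNReal.continuous_ofReal)

lemma deriv_const_add_mul_sub (c m a s : ℝ) : deriv (fun r => c + m * (r - a)) s = m := by
  simp

namespace IsClassicalSol

variable {n : ℕ} {p : ℝ} {Ω : Set (Euc n)} {u0 : Euc n → ℝ} {u : Euc n → ℝ → ℝ} {T : ℝ≥0∞}

lemma differentiableAt_time (hu : IsClassicalSol n p Ω u0 u T) {x : Euc n} (hx : x ∈ Ω) {s : ℝ}
    (hs : s ∈ TimeIoo T) : DifferentiableAt ℝ (fun r => u x r) s :=
  ((hu.time_reg x hx).contDiffAt ((isOpen_timeIoo T).mem_nhds hs)).differentiableAt (by norm_num)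

lemma cylinderRegular (hu : IsClassicalSol n p Ω u0 u T) {a b : ℝ} (h c : ℝ)
    (ha : 0 < a + h) (hb : ENNReal.ofReal (b + h) < T) :
    CylinderRegular Ω a b (fun x s => u x (s + h) + c) where
  cont := by
    refine ContinuousOn.add (hu.cont.comp (f := fun q : Euc n × ℝ => (q.1, q.2 + h))
      (by fun_prop) fun q hq => ⟨hq.1, ?_, ?_⟩) continuousOn_const
    · have := hq.2.1
      change 0 ≤ q.2 + h
      linarith
    · exact (ENNReal.ofReal_le_ofReal (by linarith [hq.2.2])).trans_lt hb
  time_diff x hx s hs := by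
    have hmem : s + h ∈ TimeIoo T :=
      ⟨by linarith [hs.1], (ENNReal.ofReal_le_ofReal (by linarith [hs.2])).trans_lt hb⟩
    exact ((hu.differentiableAt_time hx hmem).hasDerivAt.comp_add_const s
      h).differentiableAt.add_const c
  space_reg s hs := by
    have hmem : s + h ∈ TimeIoo T :=
      ⟨by linarith [hs.1], (ENNReal.ofReal_le_ofReal (by linarith [hs.2])).trans_lt hb⟩
    exact (hu.space_reg _ hmem).add contDiffOn_const

lemma deriv_shift_eq (hu : IsClassicalSol n p Ω u0 u T) {x : Euc n} (hx : x ∈ Ω) {s h : ℝ}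
    (c : ℝ) (hs : s + h ∈ TimeIoo T) :
    deriv (fun r => u x (r + h) + c) s = spatialOp n p (fun y => u y (s + h) + c) x := by
  rw [spatialOp_add_const, deriv_add_const, deriv_comp_add_const (fun r => u x r)]
  exact hu.eqn x hx _ hs

/-- Two time shifts of a solution that are ordered up to a constant `c ≥ 0` at time `a` remain so. -/
lemma shift_comparison (hu : IsClassicalSol n p Ω u0 u T) (hΩo : IsOpen Ω)
    (hΩb : Bornology.IsBounded Ω) {a b h k c : ℝ} (hah : 0 < a + h) (hak : 0 < a + k)
    (hbh : ENNReal.ofReal (b + h) < T) (hbk : ENNReal.ofReal (b + k) < T) (hc : 0 ≤ c)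
    (hic : ∀ x ∈ closure Ω, u x (a + h) ≤ u x (a + k) + c) :
    ∀ x ∈ closure Ω, ∀ s ∈ Icc a b, u x (s + h) ≤ u x (s + k) + c := by
  have hmem : ∀ {l : ℝ}, 0 < a + l → ENNReal.ofReal (b + l) < T → ∀ s ∈ Icc a b,
      s + l ∈ TimeIoo T := fun hal hbl s hs =>
    ⟨by linarith [hs.1], (ENNReal.ofReal_le_ofReal (by linarith [hs.2])).trans_lt hbl⟩
  have H := comparison_principle p hΩo hΩb (hu.cylinderRegular h 0 hah hbh)
    (hu.cylinderRegular k c hak hbk)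
    (fun x hx s hs => (hu.deriv_shift_eq hx 0 (hmem hah hbh s (Ioc_subset_Icc_self hs))).le)
    (fun x hx s hs => (hu.deriv_shift_eq hx c (hmem hak hbk s (Ioc_subset_Icc_self hs))).ge)
    (fun x hx s hs => by
      have h1 := hmem hah hbh s hs
      have h2 := hmem hak hbk s hs
      simp [hu.bc x hx _ ⟨h1.1.le, h1.2⟩, hu.bc x hx _ ⟨h2.1.le, h2.2⟩, hc])
    (fun x hx => by simpa using hic x hx)
  intro x hx s hs
  simpa using H x hx s hs

lemma cylinderRegular_affine (hu : IsClassicalSol n p Ω u0 u T) {a b : ℝ} (m : ℝ)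
    (ha : a ∈ TimeIoo T) : CylinderRegular Ω a b (fun x s => u x a + m * (s - a)) where
  cont := by
    refine ContinuousOn.add (hu.cont.comp (f := fun q : Euc n × ℝ => (q.1, a))
      (by fun_prop) fun q hq => ⟨hq.1, ha.1.le, ha.2⟩) (by fun_prop)
  time_diff x hx s hs := by fun_prop
  space_reg s hs := (hu.space_reg a ha).add contDiffOn_const

/-- A bound on `∂ₜu` at time `a` controls the growth of `u` after time `a`. -/
lemma abs_sub_le_of_abs_deriv_le (hu : IsClassicalSol n p Ω u0 u T) (hΩo : IsOpen Ω)
    (hΩb : Bornology.IsBounded Ω) {a b m : ℝ} (ha : 0 < a) (hb : ENNReal.ofReal b < T)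
    (hm : 0 ≤ m) (hbound : ∀ x ∈ Ω, |deriv (fun r => u x r) a| ≤ m) :
    ∀ x ∈ closure Ω, ∀ s ∈ Icc a b, |u x s - u x a| ≤ m * (s - a) := by
  intro x hx s hs
  have hab := hs.1.trans hs.2
  have hmem : ∀ r ∈ Icc a b, r ∈ TimeIoo T := fun r hr =>
    ⟨ha.trans_le hr.1, (ENNReal.ofReal_le_ofReal hr.2).trans_lt hb⟩
  have haT := hmem a ⟨le_rfl, hab⟩
  have hop : ∀ y ∈ Ω, spatialOp n p (fun z => u z a) y = deriv (fun r => u y r) a :=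
    fun y hy => (hu.eqn y hy a haT).symm
  have hbc : ∀ y ∈ frontier Ω, ∀ r ∈ Icc a b, u y r = 0 := fun y hy r hr =>
    hu.bc y hy r ⟨(hmem r hr).1.le, (hmem r hr).2⟩
  have hreg : CylinderRegular Ω a b u := by
    simpa using hu.cylinderRegular (a := a) (b := b) 0 0 (by simpa using ha) (by simpa using hb)
  have heqn : ∀ y ∈ Ω, ∀ r ∈ Ioc a b,
      deriv (fun r => u y r) r = spatialOp n p (fun z => u z r) y :=
    fun y hy r hr => hu.eqn y hy r (hmem r (Ioc_subset_Icc_self hr))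
  have upper := comparison_principle p hΩo hΩb hreg (hu.cylinderRegular_affine m haT)
    (fun y hy r hr => (heqn y hy r hr).le)
    (fun y hy r hr => by
      rw [spatialOp_add_const, deriv_const_add_mul_sub, hop y hy]
      exact (abs_le.mp (hbound y hy)).2)
    (fun y hy r hr => by
      rw [hbc y hy r hr, hbc y hy a ⟨le_rfl, hab⟩]
      nlinarith [mul_nonneg hm (sub_nonneg.mpr hr.1)])
    (fun y hy => by simp) x hx s hs
  have lower := comparison_principle p hΩo hΩb (hu.cylinderRegular_affine (-m) haT) hreg
    (fun y hy r hr => by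
      rw [spatialOp_add_const, deriv_const_add_mul_sub, hop y hy]
      exact (abs_le.mp (hbound y hy)).1)
    (fun y hy r hr => (heqn y hy r hr).ge)
    (fun y hy r hr => by
      rw [hbc y hy r hr, hbc y hy a ⟨le_rfl, hab⟩]
      nlinarith [mul_nonneg hm (sub_nonneg.mpr hr.1)])
    (fun y hy => by simp) x hx s hs
  rw [abs_le]
  constructor <;> linarith

/-- A bound on `|∂ₜu|` over `Ω` at one time persists at all later times. -/
lemma abs_deriv_le_of_abs_deriv_le (hu : IsClassicalSol n p Ω u0 u T) (hΩo : IsOpen Ω)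
    (hΩb : Bornology.IsBounded Ω) {a b m : ℝ} (ha : 0 < a) (hab : a ≤ b)
    (hb : ENNReal.ofReal b < T) (hm : 0 ≤ m)
    (hbound : ∀ x ∈ Ω, |deriv (fun r => u x r) a| ≤ m) {x : Euc n} (hx : x ∈ Ω) :
    |deriv (fun r => u x r) b| ≤ m := by
  have hbT : b ∈ TimeIoo T := ⟨ha.trans_le hab, hb⟩
  have hslope := (hasDerivWithinAt_iff_tendsto_slope' (s := Ioi b) self_notMem_Ioi).mp
    (hu.differentiableAt_time hx hbT).hasDerivAt.hasDerivWithinAt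
  refine le_of_tendsto hslope.abs ?_
  filter_upwards [self_mem_nhdsWithin,
    nhdsWithin_le_nhds ((isOpen_timeIoo T).mem_nhds hbT)] with c hbc hcT
  rw [mem_Ioi] at hbc
  have hincr : ∀ y ∈ closure Ω, |u y (a + (c - b)) - u y a| ≤ m * (c - b) := by
    intro y hy
    have hle : a + (c - b) ≤ c := by linarith
    have := hu.abs_sub_le_of_abs_deriv_le hΩo hΩb ha hcT.2 hm hbound y hy (a + (c - b))
      ⟨by linarith, hle⟩
    simpa using this
  have hmc : 0 ≤ m * (c - b) := mul_nonneg hm (by linarith)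
  have hcb : ENNReal.ofReal (b + (c - b)) < T := by simpa using hcT.2
  have upper := hu.shift_comparison hΩo hΩb (a := a) (b := b) (h := c - b) (k := 0)
    (by linarith) (by linarith) hcb (by simpa using hb) hmc
    (fun y hy => by
      rw [add_zero]
      linarith [(abs_le.mp (hincr y hy)).2]) x (subset_closure hx) b ⟨hab, le_rfl⟩
  have lower := hu.shift_comparison hΩo hΩb (a := a) (b := b) (h := 0) (k := c - b)
    (by linarith) (by linarith) (by simpa using hb) hcb hmc
    (fun y hy => by
      rw [add_zero]
      linarith [(abs_le.mp (hincr y hy)).1]) x (subset_closure hx) b ⟨hab, le_rfl⟩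
  rw [add_zero, add_sub_cancel] at upper lower
  rw [slope_def_field, abs_div, abs_of_pos (sub_pos.mpr hbc), div_le_iff₀ (sub_pos.mpr hbc),
    abs_le]
  constructor <;> linarith

end IsClassicalSol

/-- **Lemma 3.1 of Porretta–Souplet** (time-derivative estimate). For a classical solution of
the Dirichlet problem on `Ω̄ × [0,T)`, the sup-norm of the time derivative is nonincreasing:
for `0 < t₀ ≤ t < T`, `sup_{x∈Ω} |∂ₜu(x,t)| ≤ sup_{x∈Ω} |∂ₜu(x,t₀)|` (in `[0,∞]`). -/
theorem time_derivative_sup_nonincreasing (n : ℕ) (hn : 1 ≤ n)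
    (Ω : Set (Euc n)) (hΩo : IsOpen Ω) (hΩb : Bornology.IsBounded Ω)
    (p : ℝ) (hp : 2 < p) (u0 : Euc n → ℝ) (hu0 : MemX Ω u0)
    (u : Euc n → ℝ → ℝ) (T : ℝ≥0∞) (hT : 0 < T)
    (hu : IsClassicalSol n p Ω u0 u T)
    (t₀ t : ℝ) (ht₀ : 0 < t₀) (ht₀t : t₀ ≤ t) (htT : ENNReal.ofReal t < T) :
    (⨆ x : Ω, ENNReal.ofReal |deriv (fun s => u x.1 s) t|) ≤
      ⨆ x : Ω, ENNReal.ofReal |deriv (fun s => u x.1 s) t₀| := by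
  rcases eq_or_ne (⨆ x : Ω, ENNReal.ofReal |deriv (fun s => u x.1 s) t₀|) ⊤ with htop | hfin
  · rw [htop]
    exact le_top
  refine iSup_le fun x => ENNReal.ofReal_le_of_le_toReal ?_
  refine hu.abs_deriv_le_of_abs_deriv_le hΩo hΩb ht₀ ht₀t htT ENNReal.toReal_nonneg
    (fun y hy => ?_) x.2
  exact (ENNReal.ofReal_le_iff_le_toReal hfin).mp
    (le_iSup (fun x : Ω => ENNReal.ofReal |deriv (fun s => u x.1 s) t₀|) ⟨y, hy⟩)

end
end

section
/- Let p > 1. Suppose y : (−1, 0] → ℝ is continuous, nonnegative, locally Lipschitz, and for almost every x ∈ (−1,0], y is differentiable at x with y′(x) ≤ −y(x)^p. Then y(x) ≤ ((p−1)(x+1))^{−1/(p−1)} for every x ∈ (−1, 0]. -/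
open Set Filter MeasureTheory Topology

noncomputable section

/-- A Lipschitz function on `[a, b]` with almost everywhere nonpositive derivative satisfies
`f b ≤ f a`. -/
theorem LipschitzOnWith.le_of_ae_hasDerivAt_nonpos {K : NNReal} {f : ℝ → ℝ} {a b : ℝ}
    (hab : a ≤ b) (hf : LipschitzOnWith K f (Icc a b))
    (hderiv : ∀ᵐ x, x ∈ Ioo a b → ∃ d ≤ 0, HasDerivAt f d x) : f b ≤ f a := by
  rw [← uIcc_of_le hab] at hf
  have hftc := hf.absolutelyContinuousOnInterval.integral_deriv_eq_sub
  have hnonneg : 0 ≤ ∫ x in a..b, -deriv f x := by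
    apply intervalIntegral.integral_nonneg_of_ae_restrict hab
    rw [EventuallyLE, ← restrict_Ioo_eq_restrict_Icc, ae_restrict_iff' measurableSet_Ioo]
    filter_upwards [hderiv] with x hx hmem
    obtain ⟨d, hd, hfd⟩ := hx hmem
    simpa [hfd.deriv] using hd
  rw [intervalIntegral.integral_neg] at hnonneg
  linarith

/-- If `y` is positive and Lipschitz on `[a, b]` with `y' ≤ -y ^ p` almost everywhere, then
`y ^ (1 - p)` grows at rate at least `p - 1`. -/
theorem LipschitzOnWith.rpow_one_sub_growth {K : NNReal} {p a b : ℝ} {y : ℝ → ℝ} (hp : 1 < p)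
    (hab : a ≤ b) (hy : LipschitzOnWith K y (Icc a b)) (hpos : ∀ x ∈ Icc a b, 0 < y x)
    (hode : ∀ᵐ x, x ∈ Ioo a b → ∃ d ≤ -(y x ^ p), HasDerivAt y d x) :
    y a ^ (1 - p) + (p - 1) * (b - a) ≤ y b ^ (1 - p) := by
  have hloc : LocallyLipschitzOn (Icc a b) fun x ↦ (p - 1) * x - y x ^ (1 - p) := by
    intro x hx
    have hsmooth : ContDiffAt ℝ 1 (fun z : ℝ × ℝ ↦ (p - 1) * z.1 - z.2 ^ (1 - p)) (x, y x) := by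
      refine (contDiffAt_const.mul contDiffAt_fst).sub ?_
      exact contDiffAt_snd.rpow_const_of_ne (hpos x hx).ne'
    obtain ⟨L, t, ht, hL⟩ := hsmooth.exists_lipschitzOnWith
    have hpair : LipschitzOnWith (max 1 K) (fun x ↦ (x, y x)) (Icc a b) :=
      LipschitzWith.id.lipschitzOnWith.prodMk hy
    refine ⟨L * max 1 K, Icc a b ∩ (fun x ↦ (x, y x)) ⁻¹' t,
      inter_mem self_mem_nhdsWithin ((hpair.continuousOn x hx) ht), ?_⟩
    exact hL.comp (hpair.mono inter_subset_left) fun z hz ↦ hz.2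
  obtain ⟨L, hL⟩ := hloc.exists_lipschitzOnWith_of_compact isCompact_Icc
  have hmono := hL.le_of_ae_hasDerivAt_nonpos hab <| by
    filter_upwards [hode] with x hx hmem
    obtain ⟨d, hd, hyd⟩ := hx hmem
    have hyx := hpos x (Ioo_subset_Icc_self hmem)
    refine ⟨_, ?_, ((hasDerivAt_id x).const_mul (p - 1)).sub (hyd.rpow_const (Or.inl hyx.ne'))⟩
    have hinv : y x ^ p * y x ^ (1 - p - 1) = 1 := by
      rw [← Real.rpow_add hyx]
      simp
    have hmul : (p - 1) * (d * y x ^ (1 - p - 1)) ≤ (p - 1) * -1 := by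
      refine mul_le_mul_of_nonneg_left ?_ (by linarith)
      calc d * y x ^ (1 - p - 1) ≤ -(y x ^ p) * y x ^ (1 - p - 1) := by gcongr
        _ = -1 := by rw [neg_mul, hinv]
    linarith
  linarith

/-- **ODE comparison.** If `y : (-1,0] → ℝ` is continuous, nonnegative, locally Lipschitz, and
satisfies `y' ≤ -y^p` almost everywhere (with `p > 1`), then `y` is bounded by the maximal
solution `((p-1)(x+1))^{-1/(p-1)}` of `y' = -y^p` blowing up at `x = -1`. -/
theorem ode_comparison_blowup_bound (p : ℝ) (hp : 1 < p) (y : ℝ → ℝ)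
    (hcont : ContinuousOn y (Ioc (-1:ℝ) 0))
    (hnonneg : ∀ x ∈ Ioc (-1:ℝ) 0, 0 ≤ y x)
    (hlip : ∀ x ∈ Ioc (-1:ℝ) 0, ∃ K : NNReal, ∃ s ∈ nhdsWithin x (Ioc (-1:ℝ) 0),
      LipschitzOnWith K y s)
    (hode : ∀ᵐ x ∂(volume.restrict (Ioc (-1:ℝ) 0)),
      ∃ y' : ℝ, HasDerivWithinAt y y' (Ioc (-1:ℝ) 0) x ∧ y' ≤ -(y x ^ p)) :
    ∀ x ∈ Ioc (-1:ℝ) 0, y x ≤ ((p - 1) * (x + 1)) ^ (-(1 / (p - 1))) := by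
  have hode' : ∀ a ∈ Ioc (-1 : ℝ) 0, ∀ b ∈ Ioc (-1 : ℝ) 0,
      ∀ᵐ x, x ∈ Ioo a b → ∃ d ≤ -(y x ^ p), HasDerivAt y d x := by
    intro a ha b hb
    filter_upwards [(ae_restrict_iff' measurableSet_Ioc).1 hode] with x hx hmem
    have hleft : -1 < x := ha.1.trans hmem.1
    have hright : x < 0 := hmem.2.trans_le hb.2
    obtain ⟨d, hyd, hd⟩ := hx ⟨hleft, hright.le⟩
    exact ⟨d, hd, hyd.hasDerivAt (Ioc_mem_nhds hleft hright)⟩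
  have hsub : ∀ a ∈ Ioc (-1 : ℝ) 0, ∀ b ∈ Ioc (-1 : ℝ) 0, Icc a b ⊆ Ioc (-1 : ℝ) 0 :=
    fun a ha b hb x hx ↦ ⟨ha.1.trans_le hx.1, hx.2.trans hb.2⟩
  have hlip' : ∀ a ∈ Ioc (-1 : ℝ) 0, ∀ b ∈ Ioc (-1 : ℝ) 0,
      ∃ K, LipschitzOnWith K y (Icc a b) := fun a ha b hb ↦
    (LocallyLipschitzOn.mono hlip (hsub a ha b hb)).exists_lipschitzOnWith_of_compact isCompact_Icc
  have hanti : AntitoneOn y (Ioc (-1 : ℝ) 0) := by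
    intro a ha b hb hab
    obtain ⟨K, hK⟩ := hlip' a ha b hb
    refine hK.le_of_ae_hasDerivAt_nonpos hab ?_
    filter_upwards [hode' a ha b hb] with x hx hmem
    obtain ⟨d, hd, hyd⟩ := hx hmem
    have hyx := Real.rpow_nonneg (hnonneg x (hsub a ha b hb (Ioo_subset_Icc_self hmem))) p
    exact ⟨d, by linarith, hyd⟩
  intro x hx
  have hbase : 0 < (p - 1) * (x + 1) := mul_pos (by linarith) (by linarith [hx.1])
  rcases (hnonneg x hx).eq_or_lt with hzero | hpos
  · rw [← hzero]
    exact Real.rpow_nonneg hbase.le _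
  have hgrowth : ∀ a ∈ Ioo (-1 : ℝ) x, (p - 1) * (x - a) ≤ y x ^ (1 - p) := by
    intro a ha
    have ha' : a ∈ Ioc (-1 : ℝ) 0 := ⟨ha.1, ha.2.le.trans hx.2⟩
    obtain ⟨K, hK⟩ := hlip' a ha' x hx
    have h := hK.rpow_one_sub_growth hp ha.2.le
      (fun z hz ↦ hpos.trans_le (hanti (hsub a ha' x hx hz) hx hz.2)) (hode' a ha' x hx)
    linarith [Real.rpow_nonneg (hnonneg a ha') (1 - p)]
  have hlimit : (p - 1) * (x + 1) ≤ y x ^ (1 - p) := by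
    have htendsto : Tendsto (fun a ↦ (p - 1) * (x - a)) (𝓝[>] (-1)) (𝓝 ((p - 1) * (x - -1))) :=
      (Continuous.tendsto (by fun_prop) _).mono_left nhdsWithin_le_nhds
    rw [sub_neg_eq_add] at htendsto
    exact le_of_tendsto htendsto
      (by filter_upwards [Ioo_mem_nhdsGT hx.1] with a ha using hgrowth a ha)
  have hp' : p - 1 ≠ 0 := by linarith
  calc y x = (y x ^ (1 - p)) ^ (-(1 / (p - 1))) := by
        rw [← Real.rpow_mul hpos.le, show (1 - p) * -(1 / (p - 1)) = 1 by field_simp; ring,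
          Real.rpow_one]
    _ ≤ ((p - 1) * (x + 1)) ^ (-(1 / (p - 1))) :=
        Real.rpow_le_rpow_of_nonpos hbase hlimit
          (neg_nonpos.2 (one_div_nonneg.2 (by linarith)))

end
end

section
/- Let p > 2 and C₁ ≥ 0. Suppose g : (−1,1) → ℝ is twice continuously differentiable and satisfies g″(x) + |g′(x)|^p ≤ C₁ for all x ∈ (−1, 0]. Then for every x ∈ (−1, 0], g′(x) ≤ ((p−1)(x+1))^{−1/(p−1)} + C₁(x+1). -/
open Set Filter Topology

noncomputable section

/-- A positive solution of `w' ≤ -w ^ p` on `(a, b]` lies below the explicit solution of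
`y' = -y ^ p` that blows up at `a`. -/
theorem le_rpow_of_deriv_le_neg_rpow {p a b : ℝ} (hp : 1 < p) (hab : a < b) {w w' : ℝ → ℝ}
    (hw : ∀ x ∈ Ioc a b, HasDerivAt w (w' x) x) (hpos : ∀ x ∈ Ioc a b, 0 < w x)
    (hle : ∀ x ∈ Ioc a b, w' x ≤ -w x ^ p) :
    w b ≤ ((p - 1) * (b - a)) ^ (-(1 / (p - 1))) := by
  have hb : b ∈ Ioc a b := ⟨hab, le_rfl⟩
  have hp1 : 0 < p - 1 := by linarith
  have hder : ∀ x ∈ Ioc a b, HasDerivAt (fun x => w x ^ (1 - p) - (p - 1) * x)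
      (w' x * (1 - p) * w x ^ (1 - p - 1) - (p - 1)) x := fun x hx =>
    (((hw x hx).rpow_const (p := 1 - p) (Or.inl (hpos x hx).ne')).sub
      ((hasDerivAt_id x).const_mul (p - 1))).congr_deriv (by simp)
  have hmono : MonotoneOn (fun x => w x ^ (1 - p) - (p - 1) * x) (Ioc a b) := by
    refine monotoneOn_of_deriv_nonneg (convex_Ioc a b)
      (fun x hx => (hder x hx).continuousAt.continuousWithinAt)
      (fun x hx => (hder x (interior_subset hx)).differentiableAt.differentiableWithinAt)
      fun x hx => ?_
    have hx := interior_subset hx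
    rw [(hder x hx).deriv]
    have hmul : w x ^ p * w x ^ (1 - p - 1) = 1 := by
      rw [← Real.rpow_add (hpos x hx)]
      ring_nf
      exact Real.rpow_zero _
    have hneg : w' x * w x ^ (1 - p - 1) ≤ -1 := by
      have := mul_le_mul_of_nonneg_right (hle x hx) (Real.rpow_nonneg (hpos x hx).le (1 - p - 1))
      linarith
    nlinarith
  have hlow : (p - 1) * (b - a) ≤ w b ^ (1 - p) := by
    have hs : ∀ s ∈ Ioc a b, (p - 1) * (b - s) ≤ w b ^ (1 - p) := fun s hs => by
      have h := hmono hs hb hs.2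
      have := Real.rpow_nonneg (hpos s hs).le (1 - p)
      simp only at h
      linarith
    have hlim : Tendsto (fun s => (p - 1) * (b - s)) (𝓝[>] a) (𝓝 ((p - 1) * (b - a))) :=
      (Continuous.tendsto (by fun_prop) a).mono_left nhdsWithin_le_nhds
    exact le_of_tendsto hlim (mem_of_superset (Ioc_mem_nhdsGT hab) hs)
  calc w b = (w b ^ (1 - p)) ^ (-(1 / (p - 1))) := by
        rw [← Real.rpow_mul (hpos b hb).le,
          show (1 - p) * -(1 / (p - 1)) = 1 by field_simp; ring, Real.rpow_one]
    _ ≤ _ := Real.rpow_le_rpow_of_nonpos (mul_pos hp1 (sub_pos.2 hab)) hlow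
        (neg_nonpos.2 (one_div_pos.2 hp1).le)

/-- **One-dimensional gradient bound.** If `g ∈ C²((-1,1))` satisfies
`g'' + |g'|^p ≤ C₁` on `(-1,0]` with `p > 2` and `C₁ ≥ 0`, then
`g'(x) ≤ ((p-1)(x+1))^{-1/(p-1)} + C₁(x+1)` on `(-1,0]`. -/
theorem gradient_bound_1d (p C₁ : ℝ) (hp : 2 < p) (hC₁ : 0 ≤ C₁) (g : ℝ → ℝ)
    (hg : ContDiffOn ℝ 2 g (Ioo (-1:ℝ) 1))
    (hineq : ∀ x ∈ Ioc (-1:ℝ) 0, deriv (deriv g) x + |deriv g x| ^ p ≤ C₁) :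
    ∀ x ∈ Ioc (-1:ℝ) 0,
      deriv g x ≤ ((p - 1) * (x + 1)) ^ (-(1 / (p - 1))) + C₁ * (x + 1) := by
  intro b hb
  have hdiff : DifferentiableOn ℝ (deriv g) (Ioo (-1) 1) :=
    (hg.deriv_of_isOpen (m := 1) isOpen_Ioo (by norm_num)).differentiableOn one_ne_zero
  set w : ℝ → ℝ := fun x => deriv g x - C₁ * (x + 1) with hw_def
  have hw : ∀ x ∈ Ioc (-1 : ℝ) 0, HasDerivAt w (deriv (deriv g) x - C₁) x := fun x hx => by
    have hd := (hdiff.differentiableAt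
      (Ioo_mem_nhds hx.1 (hx.2.trans_lt one_pos))).hasDerivAt
    exact (hd.sub (((hasDerivAt_id x).add_const 1).const_mul C₁)).congr_deriv (by simp)
  have hanti : AntitoneOn w (Ioc (-1) 0) := by
    refine antitoneOn_of_deriv_nonpos (convex_Ioc _ _)
      (fun x hx => (hw x hx).continuousAt.continuousWithinAt)
      (fun x hx => (hw x (interior_subset hx)).differentiableAt.differentiableWithinAt)
      fun x hx => ?_
    have hx := interior_subset hx
    rw [(hw x hx).deriv]
    have := hineq x hx
    have := Real.rpow_nonneg (abs_nonneg (deriv g x)) p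
    linarith
  suffices h : w b ≤ ((p - 1) * (b + 1)) ^ (-(1 / (p - 1))) by
    simp only [hw_def] at h
    linarith
  rcases le_or_gt (w b) 0 with hneg | hpos
  · exact hneg.trans (Real.rpow_nonneg (mul_nonneg (by linarith) (by linarith [hb.1])) _)
  have hsub : ∀ x ∈ Ioc (-1) b, x ∈ Ioc (-1 : ℝ) 0 := fun x hx => ⟨hx.1, hx.2.trans hb.2⟩
  have hwpos : ∀ x ∈ Ioc (-1) b, 0 < w x := fun x hx =>
    hpos.trans_le (hanti (hsub x hx) hb hx.2)
  rw [← sub_neg_eq_add b]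
  refine le_rpow_of_deriv_le_neg_rpow (by linarith) hb.1 (fun x hx => hw x (hsub x hx)) hwpos
    fun x hx => ?_
  have hle : w x ≤ |deriv g x| := by
    have := mul_nonneg hC₁ (by linarith [hx.1] : 0 ≤ x + 1)
    exact (sub_le_self _ this).trans (le_abs_self _)
  have := Real.rpow_le_rpow (hwpos x hx).le hle (by linarith : 0 ≤ p)
  have := hineq x (hsub x hx)
  linarith

end
end

section
/- Let p > 2 and C₁ ≥ 0, and set β = (p−2)/(p−1). Suppose g : (−1,1) → ℝ is twice continuously differentiable, satisfies g″(x) + |g′(x)|^p ≤ C₁ for all x ∈ (−1, 0], and g(x) → 0 as x → −1⁺. Then for every x ∈ (−1, 0], g(x) ≤ c_p (x+1)^β + C₁(x+1), where c_p = (p−1)^{(p−2)/(p−1)}/(p−2). In particular, limsup_{x→−1⁺} (x+1)^{−β} g(x) ≤ c_p. -/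
open Set Filter Topology

noncomputable section

/-- A nonincreasing function whose derivative is at most `-y ^ (q + 1)` wherever `y > 0` is bounded
by the singular solution of `y' = -y ^ (q + 1)`, whatever its behaviour at the left end point. -/
theorem le_rpow_of_hasDerivAt_le_neg_rpow {y y' : ℝ → ℝ} {a b q : ℝ} (hq : 0 < q)
    (hy : ∀ x ∈ Ioc a b, HasDerivAt y (y' x) x) (hy' : ∀ x ∈ Ioc a b, y' x ≤ 0)
    (hpos : ∀ x ∈ Ioc a b, 0 < y x → y' x ≤ -(y x) ^ (q + 1)) {x : ℝ} (hx : x ∈ Ioc a b) :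
    y x ≤ (q * (x - a)) ^ (-1 / q) := by
  have hxa : 0 < q * (x - a) := mul_pos hq (sub_pos.2 hx.1)
  rcases le_or_gt (y x) 0 with h0 | h0
  · exact h0.trans (Real.rpow_nonneg hxa.le _)
  have hsub : ∀ t ∈ Ioc a x, t ∈ Ioc a b := fun t ht => ⟨ht.1, ht.2.trans hx.2⟩
  have hanti : AntitoneOn y (Ioc a b) := by
    refine antitoneOn_of_hasDerivWithinAt_nonpos (f' := y') (convex_Ioc a b)
      (fun t ht => (hy t ht).continuousAt.continuousWithinAt)
      (fun t ht => (hy t (interior_subset ht)).hasDerivWithinAt)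
      (fun t ht => hy' t (interior_subset ht))
  have hypos : ∀ t ∈ Ioc a x, 0 < y t := fun t ht => h0.trans_le (hanti (hsub t ht) hx ht.2)
  have hder : ∀ t ∈ Ioc a x, HasDerivAt (fun t => y t ^ (-q) - q * t)
      (y' t * (-q) * y t ^ (-q - 1) - q) t := fun t ht => by
    simpa using ((hy t (hsub t ht)).rpow_const (p := -q) (Or.inl (hypos t ht).ne')).fun_sub
      ((hasDerivAt_id t).const_mul q)
  have hmono : MonotoneOn (fun t => y t ^ (-q) - q * t) (Ioc a x) := by
    refine monotoneOn_of_hasDerivWithinAt_nonneg (convex_Ioc a x)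
      (fun t ht => (hder t ht).continuousAt.continuousWithinAt)
      (fun t ht => (hder t (interior_subset ht)).hasDerivWithinAt) (fun t ht => ?_)
    have ht := interior_subset ht
    have h1 := hpos t (hsub t ht) (hypos t ht)
    have h2 : y t ^ (q + 1) * y t ^ (-q - 1) = 1 := by
      rw [← Real.rpow_add (hypos t ht)]
      simp
    have h3 : 0 < y t ^ (-q - 1) := Real.rpow_pos_of_pos (hypos t ht) _
    have h4 : 1 ≤ -y' t * y t ^ (-q - 1) :=
      h2.ge.trans (mul_le_mul_of_nonneg_right (by linarith) h3.le)
    nlinarith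
  have hle : q * (x - a) ≤ y x ^ (-q) := by
    have ht : Tendsto (fun s => q * (x - s)) (𝓝[>] a) (𝓝 (q * (x - a))) :=
      Tendsto.mono_left (Continuous.tendsto (by fun_prop) a) nhdsWithin_le_nhds
    refine le_of_tendsto ht ?_
    filter_upwards [Ioc_mem_nhdsGT hx.1] with s hs
    have h1 := hmono hs ⟨hx.1, le_rfl⟩ hs.2
    have h2 := Real.rpow_pos_of_pos (hypos s hs) (-q)
    simp only at h1
    linarith
  calc y x = (y x ^ (-q)) ^ (-1 / q) := by
        rw [← Real.rpow_mul h0.le, show -q * (-1 / q) = 1 by field_simp, Real.rpow_one]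
    _ ≤ (q * (x - a)) ^ (-1 / q) :=
        Real.rpow_le_rpow_of_nonpos hxa hle (div_nonpos_of_nonpos_of_nonneg (by norm_num) hq.le)

/-- A real `limsup` is at most a nonnegative `c` as soon as the function is eventually at most
`c + ε` for every `ε > 0`; no lower bound is needed because of the convention for `sInf`. -/
theorem Real.limsup_le_of_forall_pos {α : Type*} {l : Filter α} {f : α → ℝ} {c : ℝ} (hc : 0 ≤ c)
    (h : ∀ ε > 0, ∀ᶠ x in l, f x ≤ c + ε) : limsup f l ≤ c := by
  rw [limsup_eq]
  by_cases hb : BddBelow {a | ∀ᶠ x in l, f x ≤ a}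
  · exact le_of_forall_pos_le_add fun ε hε => csInf_le hb (h ε hε)
  · rwa [Real.sInf_of_not_bddBelow hb]

/-- **Boundary upper bound (claim (7.2) of Porretta–Souplet).** If `g ∈ C²((-1,1))` satisfies
`g'' + |g'|^p ≤ C₁` on `(-1,0]` with `p > 2`, `C₁ ≥ 0`, and `g(x) → 0` as `x → -1⁺`, then with
`β = (p-2)/(p-1)` and `c_p = (p-1)^{(p-2)/(p-1)}/(p-2)` one has
`g(x) ≤ c_p (x+1)^β + C₁(x+1)` on `(-1,0]`; in particular
`limsup_{x→-1⁺} (x+1)^{-β} g(x) ≤ c_p`. -/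
theorem boundary_upper_bound_1d (p C₁ : ℝ) (hp : 2 < p) (hC₁ : 0 ≤ C₁) (g : ℝ → ℝ)
    (hg : ContDiffOn ℝ 2 g (Ioo (-1:ℝ) 1))
    (hineq : ∀ x ∈ Ioc (-1:ℝ) 0, deriv (deriv g) x + |deriv g x| ^ p ≤ C₁)
    (hlim : Tendsto g (nhdsWithin (-1) (Ioo (-1:ℝ) 1)) (nhds 0)) :
    (∀ x ∈ Ioc (-1:ℝ) 0,
      g x ≤ (p - 1) ^ ((p - 2) / (p - 1)) / (p - 2) * (x + 1) ^ ((p - 2) / (p - 1))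
          + C₁ * (x + 1)) ∧
    limsup (fun x => (x + 1) ^ (-((p - 2) / (p - 1))) * g x)
        (nhdsWithin (-1) (Ioo (-1:ℝ) 1)) ≤ (p - 1) ^ ((p - 2) / (p - 1)) / (p - 2) := by
  have hq : 0 < p - 1 := by linarith
  have hp2 : 0 < p - 2 := by linarith
  have hβ : 0 < (p - 2) / (p - 1) := div_pos hp2 hq
  have hβ1 : (p - 2) / (p - 1) - 1 = -1 / (p - 1) := by field_simp; ring
  have hsub : ∀ x ∈ Ioc (-1 : ℝ) 0, x ∈ Ioo (-1 : ℝ) 1 := fun x hx => ⟨hx.1, by linarith [hx.2]⟩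
  have hd : ∀ x ∈ Ioc (-1 : ℝ) 0, HasDerivAt g (deriv g x) x := fun x hx =>
    ((hg.differentiableOn (by norm_num)).differentiableAt
      (isOpen_Ioo.mem_nhds (hsub x hx))).hasDerivAt
  have hg' : ContDiffOn ℝ 1 (deriv g) (Ioo (-1 : ℝ) 1) :=
    hg.deriv_of_isOpen isOpen_Ioo (by norm_num)
  have hdd : ∀ x ∈ Ioc (-1 : ℝ) 0, HasDerivAt (fun x => deriv g x - C₁ * (x + 1))
      (deriv (deriv g) x - C₁) x := fun x hx => by
    simpa using (((hg'.differentiableOn (by norm_num)).differentiableAt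
      (isOpen_Ioo.mem_nhds (hsub x hx))).hasDerivAt).fun_sub
        (((hasDerivAt_id x).add_const 1).const_mul C₁)
  have hderiv : ∀ x ∈ Ioc (-1 : ℝ) 0,
      deriv g x ≤ ((p - 1) * (x + 1)) ^ (-1 / (p - 1)) + C₁ := fun x hx => by
    have h := le_rpow_of_hasDerivAt_le_neg_rpow hq hdd
      (fun t ht => by linarith [hineq t ht, Real.rpow_nonneg (abs_nonneg (deriv g t)) p])
      (fun t ht h0 => ?_) hx
    · rw [sub_neg_eq_add] at h
      nlinarith [hx.2]
    · have h1 : 0 ≤ C₁ * (t + 1) := mul_nonneg hC₁ (by linarith [ht.1])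
      have h2 : (deriv g t - C₁ * (t + 1)) ^ p ≤ |deriv g t| ^ p :=
        Real.rpow_le_rpow h0.le (by linarith [le_abs_self (deriv g t)]) (by linarith)
      rw [sub_add_cancel]
      linarith [hineq t ht]
  set β := (p - 2) / (p - 1) with hβdef
  set c := (p - 1) ^ β / (p - 2) with hcdef
  have hc : 0 ≤ c := div_nonneg (Real.rpow_nonneg hq.le _) hp2.le
  have hcβ : c * β = (p - 1) ^ (-1 / (p - 1)) := by
    rw [← hβ1, Real.rpow_sub_one hq.ne', hcdef]
    nth_rewrite 2 [hβdef]
    field_simp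
  have hFd : ∀ x ∈ Ioc (-1 : ℝ) 0,
      HasDerivAt (fun x => g x - (c * (x + 1) ^ β + C₁ * (x + 1)))
        (deriv g x - (((p - 1) * (x + 1)) ^ (-1 / (p - 1)) + C₁)) x := fun x hx => by
    have hx1 : 0 < x + 1 := by linarith [hx.1]
    have h1 : HasDerivAt (fun x : ℝ => x + 1) 1 x := (hasDerivAt_id x).add_const 1
    refine ((hd x hx).fun_sub
      (((h1.rpow_const (p := β) (Or.inl hx1.ne')).const_mul c).fun_add (h1.const_mul C₁))).congr_deriv ?_
    rw [Real.mul_rpow hq.le hx1.le, ← hcβ, hβ1]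
    ring
  have hFanti : AntitoneOn (fun x => g x - (c * (x + 1) ^ β + C₁ * (x + 1))) (Ioc (-1) 0) :=
    antitoneOn_of_hasDerivWithinAt_nonpos (convex_Ioc _ _)
      (fun t ht => (hFd t ht).continuousAt.continuousWithinAt)
      (fun t ht => (hFd t (interior_subset ht)).hasDerivWithinAt)
      (fun t ht => by linarith [hderiv t (interior_subset ht)])
  rw [nhdsWithin_Ioo_eq_nhdsGT (by norm_num : (-1 : ℝ) < 1)] at hlim ⊢
  have hbound : ∀ x ∈ Ioc (-1 : ℝ) 0, g x ≤ c * (x + 1) ^ β + C₁ * (x + 1) := fun x hx => by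
    have hcont : Tendsto (fun x : ℝ => c * (x + 1) ^ β + C₁ * (x + 1)) (𝓝[>] (-1)) (𝓝 0) := by
      have h : Continuous fun x : ℝ => c * (x + 1) ^ β + C₁ * (x + 1) :=
        ((((continuous_id.add continuous_const).rpow_const fun _ => Or.inr hβ.le)).const_mul c).add
          (by fun_prop)
      have h0 := (h.tendsto (-1)).mono_left (nhdsWithin_le_nhds (s := Ioi (-1)))
      simpa [Real.zero_rpow hβ.ne'] using h0
    have hF := hlim.sub hcont
    rw [sub_zero] at hF
    refine sub_nonpos.1 (ge_of_tendsto hF ?_)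
    filter_upwards [Ioc_mem_nhdsGT hx.1] with s hs
    exact hFanti ⟨hs.1, hs.2.trans hx.2⟩ hx hs.2
  refine ⟨hbound, Real.limsup_le_of_forall_pos hc fun ε hε => ?_⟩
  have hγ : 0 < 1 - β := by
    rw [show 1 - β = 1 / (p - 1) by rw [← neg_sub, hβ1]; ring]
    positivity
  have herr : Tendsto (fun x : ℝ => C₁ * (x + 1) ^ (1 - β)) (𝓝[>] (-1)) (𝓝 0) := by
    have h : Continuous fun x : ℝ => C₁ * (x + 1) ^ (1 - β) :=
      ((continuous_id.add continuous_const).rpow_const fun _ => Or.inr hγ.le).const_mul C₁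
    have h0 := (h.tendsto (-1)).mono_left (nhdsWithin_le_nhds (s := Ioi (-1)))
    simpa [Real.zero_rpow hγ.ne'] using h0
  filter_upwards [Ioc_mem_nhdsGT (by norm_num : (-1 : ℝ) < 0), herr.eventually_le_const hε]
    with x hx hxε
  have hx1 : 0 < x + 1 := by linarith [hx.1]
  calc (x + 1) ^ (-β) * g x ≤ (x + 1) ^ (-β) * (c * (x + 1) ^ β + C₁ * (x + 1)) := by
        gcongr
        exact hbound x hx
    _ = c + C₁ * (x + 1) ^ (1 - β) := by
        rw [Real.rpow_neg hx1.le, Real.rpow_sub hx1, Real.rpow_one]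
        have := (Real.rpow_pos_of_pos hx1 β).ne'
        field_simp
    _ ≤ c + ε := by linarith

end
end
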